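/- arXiv:1505.06756 — 4 statements merged into one kernel-verified Lean document; each statement's English description precedes it below -/
import Mathlib

section
/- There exists a microscopic set M ⊆ ℝ which does not belong to 𝓜'; hence the inclusion 𝓜' ⊆ 𝓜 is proper. -/
open MeasureTheory Filter

/-- `S ⊆ ℝ` is an interval. -/
def IsIntervalSet (S : Set ℝ) : Prop := S.OrdConnected

/-- A set `M ⊆ ℝ` is microscopic if for each `ε > 0` there is a sequence of intervals
`(J n)` covering `M` with `|J n| ≤ ε ^ (n + 1)` for each `n`. -/
def Microscopic (M : Set ℝ) : Prop :=
  ∀ ε : ℝ, 0 < ε → ∃ J : ℕ → Set ℝ,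
    (∀ n, IsIntervalSet (J n)) ∧ M ⊆ (⋃ n, J n) ∧
      ∀ n, volume (J n) ≤ ENNReal.ofReal (ε ^ (n + 1))

/-- `A ⊆ ℕ` has asymptotic density zero. -/
def DensityZero (A : Set ℕ) : Prop :=
  Tendsto (fun j : ℕ => ((A ∩ Set.Iic j).ncard : ℝ) / ((j : ℝ) + 1)) atTop (nhds 0)

/-- A set `M ⊆ ℝ` belongs to `𝓜'` if for every `ε > 0` there are `D ⊆ ℕ` of asymptotic
density zero and intervals `(J d)_{d ∈ D}` covering `M` with `|J d| ≤ ε ^ (d + 1)`. -/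
def MPrime (M : Set ℝ) : Prop :=
  ∀ ε : ℝ, 0 < ε → ∃ D : Set ℕ, DensityZero D ∧ ∃ J : ℕ → Set ℝ,
    (∀ d ∈ D, IsIntervalSet (J d)) ∧ M ⊆ (⋃ d ∈ D, J d) ∧
      ∀ d ∈ D, volume (J d) ≤ ENNReal.ofReal (ε ^ (d + 1))

/-- A sequence of rationals running through dyadic blocks `[2 ^ b, 2 ^ (b + 1))`; on the block
coded by `(j, a, r)` it lists the `2 ^ b` equally spaced points `a + r * i / 2 ^ b`. -/
noncomputable def blockCenter (n : ℕ) : ℚ :=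
  let t := (Denumerable.eqv (ℕ × ℚ × ℚ)).symm (Nat.log 2 n)
  t.2.1 + t.2.2 * ((n : ℚ) / 2 ^ Nat.log 2 n - 1)

/-- The points lying, for each `k`, in some closed ball of radius `2 ^ (-(k + 1) * (n + 1))`
around the `n`-th block center. -/
def blockSet : Set ℝ :=
  {x | ∀ k : ℕ, ∃ n : ℕ, |x - blockCenter n| ≤ (1 / 2 : ℝ) ^ ((k + 1) * (n + 1))}

lemma exists_block_index (N : ℕ) (a r : ℚ) :
    ∃ b, N ≤ b ∧ ∀ i < 2 ^ b, blockCenter (2 ^ b + i) = a + r * (i / 2 ^ b) := by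
  have hinj : Function.Injective fun j : ℕ => Denumerable.eqv (ℕ × ℚ × ℚ) (j, a, r) := by
    intro i j h
    simpa using h
  obtain ⟨b, ⟨j, rfl⟩, hb⟩ := (Set.infinite_range_of_injective hinj).exists_gt N
  refine ⟨_, hb.le, fun i hi => ?_⟩
  simp only at hi ⊢
  generalize hB : (Denumerable.eqv (ℕ × ℚ × ℚ)) (j, a, r) = b at *
  have hlog : Nat.log 2 (2 ^ b + i) = b := by
    apply Nat.log_eq_of_pow_le_of_lt_pow
    · omega
    · rw [pow_succ]; omega
  have hs : (Denumerable.eqv (ℕ × ℚ × ℚ)).symm b = (j, a, r) := by rw [← hB]; simp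
  simp only [blockCenter, hlog, hs]
  push_cast
  field_simp
  ring

lemma microscopic_blockSet : Microscopic blockSet := by
  intro ε hε
  obtain ⟨k, hk⟩ := exists_pow_lt_of_lt_one hε (by norm_num : (1 / 2 : ℝ) < 1)
  refine ⟨fun n => Metric.closedBall (blockCenter n : ℝ) ((1 / 2 : ℝ) ^ ((k + 1) * (n + 1))),
    fun n => ?_, fun x hx => ?_, fun n => ?_⟩
  · simp only [Real.closedBall_eq_Icc]
    exact Set.ordConnected_Icc
  · obtain ⟨n, hn⟩ := hx k
    exact Set.mem_iUnion.2 ⟨n, by rwa [Metric.mem_closedBall, Real.dist_eq]⟩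
  · rw [Real.volume_closedBall]
    apply ENNReal.ofReal_le_ofReal
    calc 2 * (1 / 2 : ℝ) ^ ((k + 1) * (n + 1))
        = ((1 / 2 : ℝ) ^ k) ^ (n + 1) * (1 / 2) ^ n := by rw [← pow_mul]; ring
      _ ≤ ((1 / 2 : ℝ) ^ k) ^ (n + 1) * 1 := by
          gcongr
          exact pow_le_one₀ (by norm_num) (by norm_num)
      _ ≤ ε ^ (n + 1) := by
          rw [mul_one]
          gcongr

lemma abs_sub_le_of_volume_le {S : Set ℝ} (hS : IsIntervalSet S) {δ : ℝ} (hδ : 0 ≤ δ)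
    (hv : volume S ≤ ENNReal.ofReal δ) {x y : ℝ} (hx : x ∈ S) (hy : y ∈ S) : |x - y| ≤ δ := by
  have h : ∀ {x y : ℝ}, x ∈ S → y ∈ S → y - x ≤ δ := by
    intro x y hx hy
    have := (measure_mono (hS.out hx hy)).trans hv
    rw [Real.volume_Icc] at this
    exact (ENNReal.ofReal_le_ofReal_iff hδ).1 this
  exact abs_sub_le_iff.2 ⟨h hy hx, h hx hy⟩

lemma sum_Ico_half_pow_le (m n : ℕ) :
    ∑ d ∈ Finset.Ico m n, (1 / 2 : ℝ) ^ d ≤ 2 * (1 / 2) ^ m := by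
  rcases le_total m n with h | h
  · have : ∑ d ∈ Finset.Ico m n, (1 / 2 : ℝ) ^ d = 2 * (1 / 2) ^ m - 2 * (1 / 2) ^ n := by
      induction n, h using Nat.le_induction with
      | base => simp
      | succ n hn ih => rw [Finset.sum_Ico_succ_top hn, ih]; ring
    rw [this]
    have : (0 : ℝ) < (1 / 2) ^ n := by positivity
    linarith
  · rw [Finset.Ico_eq_empty_of_le h]
    simp

/-- Few short intervals, with small total length, cannot meet all of `L` equally spaced
subintervals. -/
lemma exists_subinterval_disjoint {F : Finset ℕ} {J : ℕ → Set ℝ} {a r s : ℝ} {L m m' : ℕ}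
    (hF : F ⊆ Finset.Ico m m') (hJ : ∀ d ∈ F, IsIntervalSet (J d))
    (hv : ∀ d ∈ F, volume (J d) ≤ ENNReal.ofReal ((1 / 2) ^ (d + 1)))
    (hr : 0 < r) (hm : 4 * (1 / 2 : ℝ) ^ m ≤ r) (hL : 0 < L) (hs : s ≤ r / L)
    (hcard : 8 * (F.card : ℝ) ≤ L) :
    ∃ i < L, ∀ d ∈ F, Disjoint (Set.Icc (a + r * (i / L)) (a + r * (i / L) + s)) (J d) := by
  by_contra! hcon
  have hL' : (0 : ℝ) < L := by exact_mod_cast hL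
  have hp : ∀ d, ∃ p, (J d).Nonempty → p ∈ J d := fun d => by
    by_cases h : (J d).Nonempty
    · exact ⟨h.some, fun _ => h.some_mem⟩
    · exact ⟨0, fun h' => absurd h' h⟩
  choose p hp using hp
  have hcov : Set.Ico a (a + r) ⊆
      ⋃ d ∈ F, Metric.closedBall (p d) ((1 / 2) ^ (d + 1) + r / L) := by
    rintro x ⟨hx1, hx2⟩
    have hq0 : 0 ≤ (x - a) / r * L := by
      have : 0 ≤ x - a := by linarith
      positivity
    have hq1 : (x - a) / r * L < L := by
      have : (x - a) / r < 1 := by rw [div_lt_one hr]; linarith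
      nlinarith
    have hx : x = a + r * ((x - a) / r * L / L) := by field_simp; ring
    have hfl : ⌊(x - a) / r * L⌋₊ < L := (Nat.floor_lt hq0).2 hq1
    obtain ⟨d, hd, hnd⟩ := hcon _ hfl
    obtain ⟨y, ⟨hy1, hy2⟩, hyJ⟩ := Set.not_disjoint_iff.1 hnd
    have h1 := Nat.floor_le hq0
    have h2 := Nat.lt_floor_add_one ((x - a) / r * L)
    generalize (⌊(x - a) / r * L⌋₊ : ℕ) = i at *
    generalize (x - a) / r * L = u at *
    have h3 : a + r * (i / L) ≤ x := by
      rw [hx]; gcongr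
    have h4 : x ≤ a + r * (i / L) + r / L := by
      have : a + r * (i / L) + r / L = a + r * ((i + 1) / L) := by ring
      rw [this, hx]; gcongr
    have h5 : |x - y| ≤ r / L := abs_sub_le_iff.2 ⟨by linarith, by linarith⟩
    have h6 := abs_sub_le_of_volume_le (hJ d hd) (by positivity) (hv d hd) hyJ (hp d ⟨y, hyJ⟩)
    simp only [Set.mem_iUnion]
    refine ⟨d, hd, ?_⟩
    rw [Metric.mem_closedBall, Real.dist_eq]
    linarith [abs_sub_le x y (p d)]
  have hmeas : ENNReal.ofReal r ≤
      ENNReal.ofReal (∑ d ∈ F, 2 * ((1 / 2) ^ (d + 1) + r / L)) := by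
    calc ENNReal.ofReal r = volume (Set.Ico a (a + r)) := by simp
      _ ≤ _ := measure_mono hcov
      _ ≤ _ := measure_biUnion_finset_le _ _
      _ = _ := by
        rw [ENNReal.ofReal_sum_of_nonneg (fun _ _ => by positivity)]
        simp only [Real.volume_closedBall]
  have hle := (ENNReal.ofReal_le_ofReal_iff (Finset.sum_nonneg fun _ _ => by positivity)).1 hmeas
  have hsum : ∑ d ∈ F, 2 * ((1 / 2 : ℝ) ^ (d + 1) + r / L)
      = ∑ d ∈ F, (1 / 2 : ℝ) ^ d + F.card * (2 * (r / L)) := by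
    rw [← nsmul_eq_mul, ← Finset.sum_const, ← Finset.sum_add_distrib]
    exact Finset.sum_congr rfl fun d _ => by ring
  have hgeo : ∑ d ∈ F, (1 / 2 : ℝ) ^ d ≤ 2 * (1 / 2) ^ m :=
    (Finset.sum_le_sum_of_subset_of_nonneg hF fun _ _ _ => by positivity).trans
      (sum_Ico_half_pow_le m m')
  have hfew : F.card * (2 * (r / L)) ≤ r / 4 := by
    have : F.card * (2 * (r / L)) = (8 * F.card) * (r / L) / 4 := by ring
    rw [this]
    have h8 : 8 * (F.card : ℝ) * (r / L) ≤ L * (r / L) := by gcongr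
    rw [mul_div_cancel₀ _ hL'.ne'] at h8
    linarith
  linarith

/-- `[a, a + r]` avoids every `J d` with `d ∈ D`, `d < m`, and is long compared with the
remaining ones. -/
def IsSafe (D : Set ℕ) (J : ℕ → Set ℝ) (a r : ℚ) (m : ℕ) : Prop :=
  0 < r ∧ 4 * (1 / 2 : ℝ) ^ m ≤ r ∧
    ∀ d ∈ D, d < m → Disjoint (Set.Icc (a : ℝ) (a + r)) (J d)

lemma IsSafe.exists_refinement {D : Set ℕ} {J : ℕ → Set ℝ} (hD : DensityZero D)
    (hJ : ∀ d ∈ D, IsIntervalSet (J d))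
    (hv : ∀ d ∈ D, volume (J d) ≤ ENNReal.ofReal ((1 / 2) ^ (d + 1)))
    {a r : ℚ} {m : ℕ} (h : IsSafe D J a r m) (k : ℕ) :
    ∃ (a' r' : ℚ) (m' : ℕ), IsSafe D J a' r' m' ∧ m < m' ∧
      Set.Icc (a' : ℝ) (a' + r') ⊆ Set.Icc (a : ℝ) (a + r) ∧
      ∃ n : ℕ, ∀ x ∈ Set.Icc (a' : ℝ) (a' + r'),
        |x - blockCenter n| ≤ (1 / 2 : ℝ) ^ ((k + 1) * (n + 1)) := by
  obtain ⟨hr, hm, hdis⟩ := h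
  have hr' : (0 : ℝ) < r := by exact_mod_cast hr
  have hη : (0 : ℝ) < 1 / (8 * (2 * k + 5)) := by positivity
  obtain ⟨N₁, hN₁⟩ := eventually_atTop.1 (hD.eventually_lt_const hη)
  obtain ⟨N₂, hN₂⟩ := exists_pow_lt_of_lt_one hr' (by norm_num : (1 / 2 : ℝ) < 1)
  obtain ⟨b, hb, hblock⟩ := exists_block_index (N₁ + N₂ + m) a r
  set L := 2 ^ b with hLdef
  have hbL : b < L := Nat.lt_two_pow_self
  have hL0 : (0 : ℝ) < L := by exact_mod_cast (by omega : 0 < L)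
  have hL1 : (1 : ℝ) ≤ L := by exact_mod_cast (by omega : 1 ≤ L)
  set m' := (k + 1) * (2 * L) + 2 with hm'
  have hLm : L < m' := by rw [hm']; nlinarith
  set s : ℚ := (1 / 2) ^ ((k + 1) * (2 * L)) with hs
  have hs' : (s : ℝ) = (1 / 2) ^ ((k + 1) * (2 * L)) := by rw [hs]; push_cast; rfl
  have hsL : (s : ℝ) ≤ r / L := by
    rw [le_div_iff₀ hL0, hs']
    have h1 : (L : ℝ) ≤ 2 ^ L := by exact_mod_cast Nat.lt_two_pow_self.le
    have h2 : (1 / 2 : ℝ) ^ L ≤ (1 / 2) ^ N₂ :=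
      pow_le_pow_of_le_one (by norm_num) (by norm_num) (by omega)
    have h3 : (1 / 2 : ℝ) ^ ((k + 1) * (2 * L)) ≤ (1 / 2) ^ (L + L) :=
      pow_le_pow_of_le_one (by norm_num) (by norm_num) (by nlinarith)
    calc (1 / 2 : ℝ) ^ ((k + 1) * (2 * L)) * L ≤ (1 / 2) ^ (L + L) * 2 ^ L := by gcongr
      _ = (1 / 2) ^ L * ((1 / 2 * 2) ^ L) := by rw [mul_pow]; ring
      _ = (1 / 2) ^ L := by norm_num
      _ ≤ r := by linarith
  classical
  set F := (Finset.Ico m m').filter (· ∈ D) with hF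
  have hcard : 8 * (F.card : ℝ) ≤ L := by
    have h1 : F.card ≤ (D ∩ Set.Iic m').ncard := by
      rw [← Set.ncard_coe_finset]
      refine Set.ncard_le_ncard (fun d hd => ?_) ((Set.finite_Iic m').inter_of_right D)
      simp only [hF, Finset.coe_filter, Finset.mem_Ico, Set.mem_ofPred_eq] at hd
      exact ⟨hd.2, hd.1.2.le⟩
    have h2 := hN₁ m' (by omega)
    rw [div_lt_div_iff₀ (by positivity) (by positivity)] at h2
    have h1' : (F.card : ℝ) ≤ (D ∩ Set.Iic m').ncard := by exact_mod_cast h1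
    have h3 : (m' : ℝ) + 1 ≤ (2 * k + 5) * L := by
      rw [hm']; push_cast; linarith
    have h4 : (0 : ℝ) < 2 * k + 5 := by positivity
    have h5 : (8 * (F.card : ℝ)) * (2 * k + 5) ≤ L * (2 * k + 5) := by nlinarith
    exact le_of_mul_le_mul_right h5 h4
  obtain ⟨i, hi, hdisj⟩ := exists_subinterval_disjoint (a := (a : ℝ)) (r := r) (s := s) (m := m)
    (Finset.filter_subset _ _) (fun d hd => hJ d (Finset.mem_filter.1 hd).2)
    (fun d hd => hv d (Finset.mem_filter.1 hd).2) hr' hm (by omega) hsL hcard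
  have hc : ((blockCenter (L + i) : ℚ) : ℝ) = a + r * (i / L) := by
    rw [hblock i hi, hLdef]; push_cast; rfl
  have hsub : Set.Icc (blockCenter (L + i) : ℝ) (blockCenter (L + i) + s) ⊆
      Set.Icc (a : ℝ) (a + r) := by
    rw [hc]
    apply Set.Icc_subset_Icc
    · have : 0 ≤ (r : ℝ) * (i / L) := by positivity
      linarith
    · have h1 : (i : ℝ) + 1 ≤ L := by exact_mod_cast hi
      have h2 : (r : ℝ) * (i / L) + r / L = r * ((i + 1) / L) := by ring
      have h3 : ((i : ℝ) + 1) / L ≤ 1 := (div_le_one hL0).2 h1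
      nlinarith
  refine ⟨blockCenter (L + i), s, m', ⟨by positivity, ?_, ?_⟩, by omega, hsub, L + i, ?_⟩
  · rw [hs', hm', pow_add]
    apply le_of_eq
    ring
  · intro d hd hdm
    by_cases hdm0 : d < m
    · exact (hdis d hd hdm0).mono_left hsub
    · rw [hc]
      exact hdisj d (Finset.mem_filter.2 ⟨Finset.mem_Ico.2 ⟨by omega, hdm⟩, hd⟩)
  · rintro x ⟨hx1, hx2⟩
    rw [abs_of_nonneg (by linarith)]
    calc x - blockCenter (L + i) ≤ s := by linarith
      _ ≤ _ := by
        rw [hs']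
        exact pow_le_pow_of_le_one (by norm_num) (by norm_num)
          (Nat.mul_le_mul_left _ (by omega))

lemma not_mPrime_blockSet : ¬ MPrime blockSet := by
  intro hM
  obtain ⟨D, hD, J, hJ, hcov, hv⟩ := hM (1 / 2) (by norm_num)
  let State := {t : ℚ × ℚ × ℕ // IsSafe D J t.1 t.2.1 t.2.2}
  let I : State → Set ℝ := fun t => Set.Icc (t.1.1 : ℝ) (t.1.1 + t.1.2.1)
  have hstep : ∀ (k : ℕ) (t : State), ∃ t' : State, t.1.2.2 < t'.1.2.2 ∧ I t' ⊆ I t ∧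
      ∃ n : ℕ, ∀ x ∈ I t', |x - blockCenter n| ≤ (1 / 2 : ℝ) ^ ((k + 1) * (n + 1)) := by
    intro k t
    obtain ⟨a, r, m, h, h'⟩ := t.2.exists_refinement hD hJ hv k
    exact ⟨⟨(a, r, m), h⟩, h'⟩
  choose next hlt hsub hball using hstep
  have h0 : IsSafe D J 0 4 0 := ⟨by norm_num, by norm_num, fun d _ hd => absurd hd d.not_lt_zero⟩
  let seq : ℕ → State := fun k => Nat.rec ⟨(0, 4, 0), h0⟩ next k
  have hne : ∀ k, (I (seq k)).Nonempty := fun k => by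
    have : (0 : ℝ) < (seq k).1.2.1 := by exact_mod_cast (seq k).2.1
    exact Set.nonempty_Icc.2 (by linarith)
  obtain ⟨x, hx⟩ := IsCompact.nonempty_iInter_of_sequence_nonempty_isCompact_isClosed
    (fun k => I (seq k)) (fun k => hsub k (seq k)) hne isCompact_Icc (fun _ => isClosed_Icc)
  rw [Set.mem_iInter] at hx
  have hxM : x ∈ blockSet := fun k => by
    obtain ⟨n, hn⟩ := hball k (seq k)
    exact ⟨n, hn x (hx (k + 1))⟩
  have hxJ := hcov hxM
  simp only [Set.mem_iUnion] at hxJ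
  obtain ⟨d, hd, hxd⟩ := hxJ
  have hmono : StrictMono fun k => (seq k).1.2.2 :=
    strictMono_nat_of_lt_succ fun k => hlt k (seq k)
  have hdlt : d < (seq (d + 1)).1.2.2 := hmono.id_le (d + 1)
  exact Set.disjoint_left.1 ((seq (d + 1)).2.2.2 d hd hdlt) (hx (d + 1)) hxd

theorem exists_microscopic_not_mprime : ∃ M : Set ℝ, Microscopic M ∧ ¬ MPrime M :=
  ⟨blockSet, microscopic_blockSet, not_mPrime_blockSet⟩
end

section
/- The additivity of the ideal of microscopic sets is ℵ₁: add(𝓜) = ℵ₁, i.e., the minimum cardinality of a family 𝓐 of microscopic subsets of ℝ whose union ⋃𝓐 is not microscopic equals ℵ₁. -/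
open MeasureTheory Filter

/-! ### Countable unions -/

theorem Microscopic.iUnion {M : ℕ → Set ℝ} (hM : ∀ i, Microscopic (M i)) :
    Microscopic (⋃ i, M i) := by
  intro ε hε
  set δ := min ε 1 with hδ
  have hδ0 : 0 < δ := lt_min hε one_pos
  choose K hKi hKc hKv using fun i => hM i (δ ^ (2 ^ (i + 1))) (by positivity)
  refine ⟨fun n => K (padicValNat 2 (n + 1)) ((n + 1) / 2 ^ padicValNat 2 (n + 1) / 2),
    fun n => hKi _ _, ?_, fun n => (hKv _ _).trans (ENNReal.ofReal_le_ofReal ?_)⟩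
  · refine Set.iUnion_subset fun i x hx => ?_
    obtain ⟨j, hj⟩ := Set.mem_iUnion.1 (hKc i hx)
    refine Set.mem_iUnion.2 ⟨2 ^ i * (2 * j + 1) - 1, ?_⟩
    have h1 : 2 ^ i * (2 * j + 1) - 1 + 1 = 2 ^ i * (2 * j + 1) :=
      Nat.sub_add_cancel (Nat.mul_pos (by positivity) (by positivity))
    have h2 : padicValNat 2 (2 ^ i * (2 * j + 1)) = i := by
      rw [padicValNat.mul (by positivity) (by positivity), padicValNat.prime_pow,
        padicValNat.eq_zero_of_not_dvd (by omega), add_zero]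
    simp only [h1, h2]
    rw [Nat.mul_div_cancel_left _ (by positivity)]
    convert hj using 2
    omega
  · generalize padicValNat 2 (n + 1) = i
    rw [← pow_mul]
    calc δ ^ (2 ^ (i + 1) * ((n + 1) / 2 ^ i / 2 + 1)) ≤ δ ^ (n + 1) := by
          refine pow_le_pow_of_le_one hδ0.le (min_le_right _ _) ?_
          rw [Nat.div_div_eq_div_mul, ← pow_succ]
          exact (Nat.lt_mul_div_succ (n + 1) (by positivity)).le
      _ ≤ ε ^ (n + 1) := pow_le_pow_left₀ hδ0.le (min_le_left _ _) _

theorem microscopic_empty : Microscopic ∅ := fun ε hε =>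
  ⟨fun _ => ∅, fun _ => Set.ordConnected_empty, Set.empty_subset _, fun _ => by simp⟩

theorem Microscopic.sUnion {𝓐 : Set (Set ℝ)} (hc : 𝓐.Countable)
    (h : ∀ M ∈ 𝓐, Microscopic M) : Microscopic (⋃₀ 𝓐) := by
  rcases 𝓐.eq_empty_or_nonempty with rfl | hne
  · simpa using microscopic_empty
  · obtain ⟨f, rfl⟩ := hc.exists_eq_range hne
    rw [Set.sUnion_range]
    exact Microscopic.iUnion fun i => h _ ⟨i, rfl⟩

/-! ### A `Gδ` set of binary sequences with long runs of zeros -/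

/-- The binary sequences that, for every `e`, agree with the binary expansion of some
natural number `N` (least significant digit first) on the first `4 ^ e * (N + 1)` places. -/
def zeroRunSet : Set (ℕ → Bool) :=
  {x | ∀ e : ℕ, ∃ N : ℕ, ∀ p < 4 ^ e * (N + 1), x p = N.testBit p}

theorem testBit_eq_iff_modEq_two_pow {a b n : ℕ} :
    (∀ p < n, a.testBit p = b.testBit p) ↔ a ≡ b [MOD 2 ^ n] := by
  constructor
  · intro h
    refine Nat.eq_of_testBit_eq fun i => ?_
    simp only [Nat.testBit_mod_two_pow]
    by_cases hi : i < n <;> simp [hi, h]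
  · intro h p hp
    have := congrArg (fun c => c.testBit p) h
    simpa [Nat.testBit_mod_two_pow, hp] using this

theorem testBit_eq_iff_modEq_four_pow {a b n : ℕ} :
    (∀ p < 2 * n, a.testBit p = b.testBit p) ↔ a ≡ b [MOD 4 ^ n] := by
  rw [testBit_eq_iff_modEq_two_pow, pow_mul]
  norm_num

open Classical in
theorem card_filter_testBit_eq_le (u : ℕ → Bool) (m n : ℕ) :
    (((Finset.range m).filter fun N => ∀ p < 2 * n, u p = N.testBit p).card : ℝ) ≤
      m / 4 ^ n + 1 := by
  rcases Finset.eq_empty_or_nonempty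
    ((Finset.range m).filter fun N => ∀ p < 2 * n, u p = N.testBit p) with h | ⟨N₀, h₀⟩
  · rw [h]
    simp only [Finset.card_empty, Nat.cast_zero]
    positivity
  · have h₁ := (Finset.mem_filter.1 h₀).2
    have hsub : ((Finset.range m).filter fun N => ∀ p < 2 * n, u p = N.testBit p) ⊆
        (Finset.range m).filter fun N => N ≡ N₀ [MOD 4 ^ n] := by
      intro N hN
      rw [Finset.mem_filter] at hN ⊢
      refine ⟨hN.1, testBit_eq_iff_modEq_four_pow.1 fun p hp => ?_⟩
      rw [← hN.2 p hp, h₁ p hp]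
    have h2 := Finset.card_le_card hsub
    rw [← Nat.count_eq_card_filter_range (· ≡ N₀ [MOD 4 ^ n]) m,
      Nat.count_modEq_card m (pow_pos (by norm_num) n) N₀] at h2
    have h3 : ((Finset.range m).filter fun N => ∀ p < 2 * n, u p = N.testBit p).card ≤
        m / 4 ^ n + 1 := by
      refine h2.trans ?_
      split_ifs <;> omega
    calc _ ≤ ((m / 4 ^ n + 1 : ℕ) : ℝ) := by exact_mod_cast h3
      _ ≤ _ := by
        push_cast
        gcongr
        exact_mod_cast Nat.cast_div_le (α := ℝ) (m := m) (n := 4 ^ n)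

theorem card_filter_modEq_four_pow (q j t : ℕ) :
    ((Finset.range (4 ^ (q + j))).filter fun N => N ≡ t [MOD 4 ^ q]).card = 4 ^ j := by
  rw [← Nat.count_eq_card_filter_range, Nat.count_modEq_card _ (by positivity), pow_add]
  simp

theorem sum_Ico_quarter_pow_le (q Q : ℕ) :
    ∑ n ∈ Finset.Ico q Q, (1 / 4 ^ (n + 1) : ℝ) ≤ 1 / 3 / 4 ^ q := by
  rcases le_total Q q with h | h
  · rw [Finset.Ico_eq_empty_of_le h, Finset.sum_empty]
    positivity
  · have key : ∑ n ∈ Finset.Ico q Q, (1 / 4 ^ (n + 1) : ℝ) = 1 / 3 / 4 ^ q - 1 / 3 / 4 ^ Q := by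
      induction Q, h using Nat.le_induction with
      | base => simp
      | succ Q hQ ih =>
        rw [Finset.sum_Ico_succ_top hQ, ih, pow_succ]
        field_simp
        ring
    rw [key]
    have : (0 : ℝ) < 1 / 3 / 4 ^ Q := by positivity
    linarith

open Classical in
/-- `A` has zero lower density along the powers of `4`. -/
def IsSparse (A : Set ℕ) : Prop :=
  ∀ d : ℕ, ∃ᶠ r in atTop, d * ((Finset.range (4 ^ r)).filter (· ∈ A)).card < 4 ^ r

/-- The cylinder of the first `2 * q` binary digits of `t` misses the cylinders of length
`2 * (n + 1)` around `u n` for all `n ∈ A` below `q`. -/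
def AvoidsBelow (A : Set ℕ) (u : ℕ → ℕ → Bool) (q t : ℕ) : Prop :=
  ∀ n ∈ A, n < q → ∃ p < 2 * (n + 1), u n p ≠ t.testBit p

open Classical in
theorem AvoidsBelow.exists_extension {A : Set ℕ} (hA : IsSparse A) {u : ℕ → ℕ → Bool} (e : ℕ)
    {q t : ℕ} (h : AvoidsBelow A u q t) :
    ∃ q' t', q < q' ∧ (∀ p < 2 * q, t'.testBit p = t.testBit p) ∧
      4 ^ e * (t' + 1) ≤ 2 * q' ∧ AvoidsBelow A u q' t' := by
  obtain ⟨r, hr, hcard⟩ := (frequently_atTop.1 (hA (2 * 4 ^ (e + q)))) (e + q)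
  obtain ⟨j, rfl⟩ := Nat.exists_eq_add_of_le hr
  set Q := 4 ^ (e + q + j) with hQ
  set a := ((Finset.range Q).filter (· ∈ A)).card with ha
  have ha2 : 2 * a < 4 ^ j := by
    have h1 : 4 ^ (e + q) * (2 * a) < 4 ^ (e + q) * 4 ^ j := by
      rw [← pow_add, ← hQ]
      linarith
    exact lt_of_mul_lt_mul_left h1 (by positivity)
  let B : ℕ → Finset ℕ := fun n =>
    (Finset.range (4 ^ (q + j))).filter fun N => ∀ p < 2 * (n + 1), u n p = N.testBit p
  let T : Finset ℕ := (Finset.Ico q Q).filter (· ∈ A)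
  have hTa : T.card ≤ a := by
    refine Finset.card_le_card fun n hn => ?_
    simp only [T, Finset.mem_filter, Finset.mem_Ico] at hn
    simp [hn.1.2, hn.2]
  have hbad : ((T.biUnion B).card : ℝ) < 4 ^ j := by
    have h1 : ((T.biUnion B).card : ℝ) ≤ ∑ n ∈ T, ((B n).card : ℝ) := by
      exact_mod_cast Finset.card_biUnion_le
    have h2 : ∑ n ∈ T, ((B n).card : ℝ) ≤
        ∑ n ∈ T, ((4 : ℝ) ^ (q + j) * (1 / 4 ^ (n + 1)) + 1) := by
      refine Finset.sum_le_sum fun n _ => ?_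
      have := card_filter_testBit_eq_le (u n) (4 ^ (q + j)) (n + 1)
      push_cast at this
      rwa [mul_one_div]
    have h3 : ∑ n ∈ T, (1 / 4 ^ (n + 1) : ℝ) ≤ 1 / 3 / 4 ^ q :=
      (Finset.sum_le_sum_of_subset_of_nonneg (Finset.filter_subset _ _)
        fun _ _ _ => by positivity).trans (sum_Ico_quarter_pow_le q Q)
    rw [Finset.sum_add_distrib, ← Finset.mul_sum, Finset.sum_const, nsmul_one] at h2
    have h4 : (4 : ℝ) ^ (q + j) * ∑ n ∈ T, (1 / 4 ^ (n + 1) : ℝ) ≤ 4 ^ j / 3 := by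
      calc (4 : ℝ) ^ (q + j) * ∑ n ∈ T, (1 / 4 ^ (n + 1) : ℝ)
          ≤ 4 ^ (q + j) * (1 / 3 / 4 ^ q) := by gcongr
        _ = 4 ^ j / 3 := by rw [pow_add]; field_simp
    have h5 : (T.card : ℝ) ≤ a := by exact_mod_cast hTa
    have h6 : 2 * (a : ℝ) < 4 ^ j := by exact_mod_cast ha2
    linarith
  obtain ⟨N, hN, hNB⟩ : ∃ N ∈ (Finset.range (4 ^ (q + j))).filter
      (fun N => N ≡ t [MOD 4 ^ q]), N ∉ T.biUnion B := by
    refine Finset.exists_mem_notMem_of_card_lt_card ?_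
    rw [card_filter_modEq_four_pow]
    exact_mod_cast hbad
  rw [Finset.mem_filter, Finset.mem_range] at hN
  have hNt := testBit_eq_iff_modEq_four_pow.2 hN.2
  have hqQ : q < Q := (Nat.lt_pow_self (by norm_num)).trans_le
    (Nat.pow_le_pow_right (by norm_num) (by omega))
  refine ⟨Q, N, hqQ, hNt, ?_, fun n hnA hnQ => ?_⟩
  · calc 4 ^ e * (N + 1) ≤ 4 ^ e * 4 ^ (q + j) := Nat.mul_le_mul_left _ hN.1
      _ = Q := by rw [hQ, ← pow_add, add_assoc]
      _ ≤ 2 * Q := by omega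
  · rcases lt_or_ge n q with hnq | hnq
    · obtain ⟨p, hp, hup⟩ := h n hnA hnq
      exact ⟨p, hp, by rwa [hNt p (by omega)]⟩
    · by_contra! hcon
      refine hNB (Finset.mem_biUnion.2 ⟨n, ?_, ?_⟩)
      · simp [T, hnq, hnQ, hnA]
      · simp only [B, Finset.mem_filter, Finset.mem_range]
        exact ⟨hN.1, hcon⟩

theorem IsSparse.exists_mem_zeroRunSet {A : Set ℕ} (hA : IsSparse A) (u : ℕ → ℕ → Bool) :
    ∃ x ∈ zeroRunSet, ∀ n ∈ A, ∃ p < 2 * (n + 1), u n p ≠ x p := by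
  choose! Q T hQ hT hQT hav using
    fun (e q t : ℕ) (h : AvoidsBelow A u q t) => h.exists_extension hA e
  let s : ℕ → ℕ × ℕ := fun k =>
    Nat.rec (0, 0) (fun e c => (Q e c.1 c.2, T e c.1 c.2)) k
  have hs (k : ℕ) : s (k + 1) = (Q k (s k).1 (s k).2, T k (s k).1 (s k).2) := rfl
  have hsav (k : ℕ) : AvoidsBelow A u (s k).1 (s k).2 := by
    induction k with
    | zero => exact fun n _ hn => absurd hn (Nat.not_lt_zero n)
    | succ k ih => exact hav k _ _ ih
  have hlt (k : ℕ) : (s k).1 < (s (k + 1)).1 := hQ k _ _ (hsav k)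
  have hmono : StrictMono fun k => (s k).1 := strictMono_nat_of_lt_succ hlt
  have hcoh (k k' : ℕ) (hk : k ≤ k') :
      ∀ p < 2 * (s k).1, (s k').2.testBit p = (s k).2.testBit p := by
    induction k', hk using Nat.le_induction with
    | base => exact fun _ _ => rfl
    | succ m hm ih =>
      intro p hp
      have : (s k).1 ≤ (s m).1 := hmono.monotone hm
      rw [← ih p hp, hs]
      exact hT m _ _ (hsav m) p (by omega)
  have hge (k : ℕ) : k ≤ (s k).1 := hmono.le_apply
  let x : ℕ → Bool := fun p => (s (p + 1)).2.testBit p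
  have hx (k : ℕ) : ∀ p < 2 * (s k).1, x p = (s k).2.testBit p := by
    intro p hp
    rcases le_total k (p + 1) with h | h
    · exact hcoh k (p + 1) h p hp
    · have := hge (p + 1)
      exact (hcoh (p + 1) k h p (by omega)).symm
  refine ⟨x, fun e => ⟨(s (e + 1)).2, fun p hp => hx (e + 1) p (hp.trans_le ?_)⟩, ?_⟩
  · exact hQT e _ _ (hsav e)
  · intro n hn
    have h1 := hge (n + 1)
    obtain ⟨p, hp, hup⟩ := hsav (n + 1) n hn (by omega)
    exact ⟨p, hp, by rwa [hx (n + 1) p (by omega)]⟩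

/-! ### Almost disjoint sets of indices -/

open Classical in
/-- An infinite almost disjoint family of sets of naturals cannot consist of sets whose lower
densities along the powers of `4` are bounded away from zero. -/
theorem exists_not_eventually_of_almost_disjoint {ι : Type*} {S : Set ι} (hS : S.Infinite)
    {A : ι → Set ℕ} (hA : ∀ i j, i ≠ j → ∀ᶠ n in atTop, ¬ (n ∈ A i ∧ n ∈ A j)) (d : ℕ) :
    ∃ i ∈ S, ¬ ∀ᶠ r in atTop,
      4 ^ r ≤ d * ((Finset.range (4 ^ r)).filter (· ∈ A i)).card := by
  by_contra! hcon
  obtain ⟨F, hFS, hF⟩ := hS.exists_subset_card_eq (d + 1)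
  have hdisj : ∀ᶠ n in atTop, ∀ i ∈ F, ∀ j ∈ F, i ≠ j → ¬ (n ∈ A i ∧ n ∈ A j) := by
    refine (eventually_all_finset F).2 fun i _ => (eventually_all_finset F).2 fun j _ => ?_
    by_cases hij : i = j
    · simp [hij]
    · filter_upwards [hA i j hij] with n hn _ using hn
  obtain ⟨N, hN⟩ := eventually_atTop.1 hdisj
  have hcard : ∀ᶠ r in atTop, ∀ i ∈ F,
      4 ^ r ≤ d * ((Finset.range (4 ^ r)).filter (· ∈ A i)).card :=
    (eventually_all_finset F).2 fun i hi => hcon i (hFS hi)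
  obtain ⟨r, hr, hrN⟩ := (hcard.and (eventually_ge_atTop (d * ((d + 1) * N)))).exists
  let C : ι → Finset ℕ := fun i => (Finset.Ico N (4 ^ r)).filter (· ∈ A i)
  have hC : ∑ i ∈ F, (C i).card ≤ 4 ^ r := by
    rw [← Finset.card_biUnion]
    · calc (F.biUnion C).card ≤ (Finset.range (4 ^ r)).card := by
            refine Finset.card_le_card fun n hn => ?_
            simp only [C, Finset.mem_biUnion, Finset.mem_filter, Finset.mem_Ico] at hn
            obtain ⟨i, -, hi⟩ := hn
            exact Finset.mem_range.2 hi.1.2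
        _ = 4 ^ r := Finset.card_range _
    · intro i hi j hj hij
      refine Finset.disjoint_left.2 fun n hni hnj => ?_
      simp only [C, Finset.mem_filter, Finset.mem_Ico] at hni hnj
      exact hN n hni.1.1 i hi j hj hij ⟨hni.2, hnj.2⟩
  have hAC (i : ι) : ((Finset.range (4 ^ r)).filter (· ∈ A i)).card ≤ N + (C i).card := by
    calc _ ≤ (Finset.range N ∪ C i).card := by
          refine Finset.card_le_card fun n hn => ?_
          simp only [C, Finset.mem_union, Finset.mem_filter, Finset.mem_Ico,
            Finset.mem_range] at hn ⊢
          rcases lt_or_ge n N with h | h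
          · exact Or.inl h
          · exact Or.inr ⟨⟨h, hn.1⟩, hn.2⟩
      _ ≤ _ := by simpa using Finset.card_union_le (Finset.range N) (C i)
  have hsum : (d + 1) * 4 ^ r ≤ d * ((d + 1) * N + 4 ^ r) := by
    calc (d + 1) * 4 ^ r = ∑ i ∈ F, 4 ^ r := by simp [hF]
      _ ≤ ∑ i ∈ F, d * (N + (C i).card) :=
          Finset.sum_le_sum fun i hi => (hr i hi).trans (Nat.mul_le_mul_left _ (hAC i))
      _ = d * ((d + 1) * N + ∑ i ∈ F, (C i).card) := by
          rw [← Finset.mul_sum, Finset.sum_add_distrib]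
          simp [hF]
      _ ≤ _ := by gcongr
  have hrr : r < 4 ^ r := Nat.lt_pow_self (by norm_num)
  nlinarith

/-- Uncountably many copies of `zeroRunSet` cannot be covered by a sequence of product
cylinders of lengths `2 * (n + 1)`. -/
theorem exists_not_covered {Y : Set (ℕ → Bool)} (hY : ¬ Y.Countable) (u v : ℕ → ℕ → Bool) :
    ∃ y ∈ Y, ∃ x ∈ zeroRunSet, ∀ n, ∃ p < 2 * (n + 1), ¬ (u n p = x p ∧ v n p = y p) := by
  classical
  by_contra! hcon
  obtain ⟨A, hA⟩ : ∃ A : (ℕ → Bool) → Set ℕ,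
      ∀ y n, n ∈ A y ↔ ∀ p < 2 * (n + 1), v n p = y p :=
    ⟨fun y => {n | ∀ p < 2 * (n + 1), v n p = y p}, fun _ _ => Iff.rfl⟩
  have hsp : ∀ y ∈ Y, ¬ IsSparse (A y) := by
    intro y hy hs
    obtain ⟨x, hx, hux⟩ := hs.exists_mem_zeroRunSet u
    obtain ⟨n, hn⟩ := hcon y hy x hx
    obtain ⟨p, hp, hne⟩ := hux n ((hA y n).2 fun p hp => (hn p hp).2)
    exact hne (hn p hp).1
  let S : ℕ → Set (ℕ → Bool) := fun d => {y | ∀ᶠ r in atTop,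
    4 ^ r ≤ d * ((Finset.range (4 ^ r)).filter (· ∈ A y)).card}
  have hYS : Y ⊆ ⋃ d, S d := by
    intro y hy
    have := hsp y hy
    simp only [IsSparse, not_forall, not_frequently, not_lt] at this
    exact Set.mem_iUnion.2 this
  have hSinf : ∃ d, (S d).Infinite := by
    by_contra! hfin
    exact hY ((Set.countable_iUnion fun d => (hfin d).countable).mono hYS)
  obtain ⟨d, hd⟩ := hSinf
  have hdisj : ∀ y z, y ≠ z → ∀ᶠ n in atTop, ¬ (n ∈ A y ∧ n ∈ A z) := by
    intro y z hyz
    obtain ⟨p, hp⟩ := Function.ne_iff.1 hyz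
    filter_upwards [eventually_ge_atTop p] with n hn hmem
    exact hp ((((hA y n).1 hmem.1) p (by omega)).symm.trans (((hA z n).1 hmem.2) p (by omega)))
  obtain ⟨y, hyS, hy⟩ := exists_not_eventually_of_almost_disjoint hd hdisj d
  exact hy hyS

/-! ### Transfer to the real line -/

theorem Real.ofDigits_agree_of_abs_sub_lt {b : ℕ} {a c : ℕ → Fin b}
    (hac : ∀ i, a i ≠ c i → 2 ≤ |((a i : ℕ) : ℝ) - (c i : ℕ)|) {n : ℕ}
    (h : |Real.ofDigits a - Real.ofDigits c| < ((b : ℝ) ^ n)⁻¹) : ∀ i < n, a i = c i := by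
  induction n generalizing a c with
  | zero => simp
  | succ n ih =>
    have hb : (0 : ℝ) < b := by exact_mod_cast Fin.pos (a 0)
    have hb1 : (1 : ℝ) ≤ b := by exact_mod_cast Fin.pos (a 0)
    set α := Real.ofDigits fun i => a (i + 1) with hα
    set γ := Real.ofDigits fun i => c (i + 1) with hγ
    have key : Real.ofDigits a - Real.ofDigits c =
        (b : ℝ)⁻¹ * ((((a 0 : ℕ) : ℝ) - (c 0 : ℕ)) + (α - γ)) := by
      rw [Real.ofDigits_eq_sum_add_ofDigits a 1, Real.ofDigits_eq_sum_add_ofDigits c 1]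
      simp only [Finset.range_one, Finset.sum_singleton, Real.ofDigitsTerm, zero_add, pow_one]
      ring
    rw [key, abs_mul, abs_of_pos (inv_pos.2 hb), pow_succ', mul_inv] at h
    have h' := lt_of_mul_lt_mul_left h (inv_pos.2 hb).le
    have h0 : a 0 = c 0 := by
      by_contra hne
      have h1 := hac 0 hne
      have h2 : |α - γ| ≤ 1 := by
        have := Real.ofDigits_nonneg fun i => a (i + 1)
        have := Real.ofDigits_nonneg fun i => c (i + 1)
        have := Real.ofDigits_le_one fun i => a (i + 1)
        have := Real.ofDigits_le_one fun i => c (i + 1)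
        rw [abs_le]
        constructor <;> linarith
      have h3 : ((b : ℝ) ^ n)⁻¹ ≤ 1 := inv_le_one_of_one_le₀ (one_le_pow₀ hb1)
      have h4 := abs_sub_abs_le_abs_add (((a 0 : ℕ) : ℝ) - (c 0 : ℕ)) (α - γ)
      linarith
    rw [h0, sub_self, zero_add] at h'
    have := ih (fun i => hac (i + 1)) h'
    intro i hi
    cases i with
    | zero => exact h0
    | succ i => exact this i (by omega)

/-- The octal digit `2 * s + 4 * t`. -/
def pairDigit (s t : Bool) : Fin 8 :=
  bif s then (bif t then 6 else 2) else (bif t then 4 else 0)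

/-- The real number in `[0, 1]` coding a pair of binary sequences by even octal digits. -/
noncomputable def pairReal (x y : ℕ → Bool) : ℝ :=
  Real.ofDigits fun p => pairDigit (x p) (y p)

theorem abs_pairReal_sub_le {x y x' y' : ℕ → Bool} {n : ℕ}
    (hx : ∀ p < n, x p = x' p) (hy : ∀ p < n, y p = y' p) :
    |pairReal x y - pairReal x' y'| ≤ ((8 : ℝ) ^ n)⁻¹ := by
  have := Real.abs_ofDigits_sub_ofDigits_le (b := 8) (n := n)
    (x := fun p => pairDigit (x p) (y p)) (y := fun p => pairDigit (x' p) (y' p))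
    fun p hp => by rw [hx p hp, hy p hp]
  exact_mod_cast this

theorem agree_of_abs_pairReal_sub_lt {x y x' y' : ℕ → Bool} {n : ℕ}
    (h : |pairReal x y - pairReal x' y'| < ((8 : ℝ) ^ n)⁻¹) :
    ∀ p < n, x p = x' p ∧ y p = y' p := by
  intro p hp
  have h1 := Real.ofDigits_agree_of_abs_sub_lt (b := 8) (n := n)
    (a := fun p => pairDigit (x p) (y p)) (c := fun p => pairDigit (x' p) (y' p)) ?_
    (by exact_mod_cast h) p hp
  · revert h1
    generalize x p = s, y p = t, x' p = s', y' p = t'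
    revert s t s' t'
    decide
  · intro i
    generalize x i = s, y i = t, x' i = s', y' i = t'
    cases s <;> cases t <;> cases s' <;> cases t' <;> norm_num [pairDigit, abs_of_nonneg]

theorem microscopic_pairReal_image_zeroRunSet (y : ℕ → Bool) :
    Microscopic ((fun x => pairReal x y) '' zeroRunSet) := by
  intro ε hε
  obtain ⟨e, he⟩ : ∃ e : ℕ, 2 * ((1 / 8 : ℝ) ^ e) < ε := by
    obtain ⟨e, he⟩ := exists_pow_lt_of_lt_one (half_pos hε) (by norm_num : (1 / 8 : ℝ) < 1)
    exact ⟨e, by linarith⟩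
  let c : ℕ → ℝ := fun n => pairReal (fun p => n.testBit p) y
  let ρ : ℕ → ℝ := fun n => ((8 : ℝ) ^ (4 ^ e * (n + 1)))⁻¹
  refine ⟨fun n => Set.Icc (c n - ρ n) (c n + ρ n), fun n => Set.ordConnected_Icc, ?_, ?_⟩
  · rintro _ ⟨x, hx, rfl⟩
    obtain ⟨N, hN⟩ := hx e
    refine Set.mem_iUnion.2 ⟨N, ?_⟩
    have := abs_le.1 (abs_pairReal_sub_le (y := y) (y' := y) hN fun _ _ => rfl)
    constructor <;> simp only [c, ρ] <;> linarith
  · intro n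
    rw [Real.volume_Icc]
    refine ENNReal.ofReal_le_ofReal ?_
    calc c n + ρ n - (c n - ρ n) = 2 * ((1 / 8 : ℝ) ^ 4 ^ e) ^ (n + 1) := by
          simp only [ρ, ← pow_mul, one_div, inv_pow]
          ring
      _ ≤ 2 ^ (n + 1) * ((1 / 8 : ℝ) ^ 4 ^ e) ^ (n + 1) := by
          gcongr
          exact le_self_pow₀ (by norm_num) (by omega)
      _ = (2 * (1 / 8 : ℝ) ^ 4 ^ e) ^ (n + 1) := (mul_pow _ _ _).symm
      _ ≤ (2 * (1 / 8 : ℝ) ^ e) ^ (n + 1) := by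
          have : (1 / 8 : ℝ) ^ 4 ^ e ≤ (1 / 8) ^ e :=
            pow_le_pow_of_le_one (by norm_num) (by norm_num)
              (Nat.lt_pow_self (by norm_num)).le
          gcongr
      _ ≤ ε ^ (n + 1) := by gcongr

theorem IsIntervalSet.abs_sub_le {J : Set ℝ} (hJ : IsIntervalSet J) {r : ℝ} (hr : 0 ≤ r)
    (hv : volume J ≤ ENNReal.ofReal r) {a b : ℝ} (ha : a ∈ J) (hb : b ∈ J) : |a - b| ≤ r := by
  have h : volume (Set.uIcc b a) ≤ ENNReal.ofReal r :=
    (measure_mono (Set.OrdConnected.uIcc_subset hJ hb ha)).trans hv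
  rwa [Real.volume_interval, ENNReal.ofReal_le_ofReal_iff hr] at h

theorem not_microscopic_sUnion_pairReal_image {Y : Set (ℕ → Bool)} (hY : ¬ Y.Countable) :
    ¬ Microscopic (⋃₀ ((fun y => (fun x => pairReal x y) '' zeroRunSet) '' Y)) := by
  intro hmic
  obtain ⟨J, hJ, hcov, hvol⟩ := hmic (1 / 128) (by norm_num)
  have hex (n : ℕ) : ∃ w : (ℕ → Bool) × (ℕ → Bool),
      (∃ x y, pairReal x y ∈ J n) → pairReal w.1 w.2 ∈ J n := by
    by_cases h : ∃ x y, pairReal x y ∈ J n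
    · obtain ⟨x, y, h⟩ := h
      exact ⟨(x, y), fun _ => h⟩
    · exact ⟨(fun _ => false, fun _ => false), fun h' => absurd h' h⟩
  choose w hw using hex
  obtain ⟨y, hy, x, hx, hxy⟩ := exists_not_covered hY (fun n => (w n).1) (fun n => (w n).2)
  obtain ⟨n, hn⟩ := Set.mem_iUnion.1
    (hcov (Set.mem_sUnion.2 ⟨_, ⟨y, hy, rfl⟩, ⟨x, hx, rfl⟩⟩))
  have h1 := (hJ n).abs_sub_le (by positivity) (hvol n) (hw n ⟨x, y, hn⟩) hn
  have h2 : (1 / 128 : ℝ) ^ (n + 1) < ((8 : ℝ) ^ (2 * (n + 1)))⁻¹ := by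
    rw [pow_mul, ← inv_pow]
    exact pow_lt_pow_left₀ (by norm_num) (by norm_num) (by omega)
  obtain ⟨p, hp, hne⟩ := hxy n
  exact hne (agree_of_abs_pairReal_sub_lt (h1.trans_lt h2) p hp)

theorem add_microscopic_eq_aleph_one :
    sInf {c : Cardinal | ∃ 𝓐 : Set (Set ℝ), (∀ M ∈ 𝓐, Microscopic M) ∧
      ¬ Microscopic (⋃₀ 𝓐) ∧ Cardinal.mk ↥𝓐 = c} = Cardinal.aleph 1 := by
  obtain ⟨Y, hY⟩ : ∃ Y : Set (ℕ → Bool), Cardinal.mk Y = Cardinal.aleph 1 := by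
    refine Cardinal.le_mk_iff_exists_set.1 ?_
    simpa using Cardinal.aleph_one_le_continuum
  have hYc : ¬ Y.Countable := by
    rw [← Cardinal.le_aleph0_iff_set_countable, hY, not_le]
    exact Cardinal.aleph0_lt_aleph_one
  have hmem : Cardinal.mk ((fun y => (fun x => pairReal x y) '' zeroRunSet) '' Y) ∈
      {c : Cardinal | ∃ 𝓐 : Set (Set ℝ), (∀ M ∈ 𝓐, Microscopic M) ∧
        ¬ Microscopic (⋃₀ 𝓐) ∧ Cardinal.mk ↥𝓐 = c} := by
    refine ⟨_, ?_, not_microscopic_sUnion_pairReal_image hYc, rfl⟩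
    rintro _ ⟨y, -, rfl⟩
    exact microscopic_pairReal_image_zeroRunSet y
  refine le_antisymm ((csInf_le' hmem).trans (Cardinal.mk_image_le.trans hY.le)) ?_
  refine le_csInf ⟨_, hmem⟩ ?_
  rintro _ ⟨𝓐, h𝓐, hU, rfl⟩
  by_contra! hlt
  exact hU (Microscopic.sUnion (Cardinal.le_aleph0_iff_set_countable.1 (Cardinal.lt_aleph_one_iff.1 hlt)) h𝓐)
end

section
/- There exists a family (X_α)_{α<ω₁} of microscopic subsets of ℝ, indexed by the countable ordinals, such that ⋃_{α<ω₁} X_α is not microscopic. -/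
open MeasureTheory Filter

open Finset in
theorem card_le_div_add_one_of_modEq {T : Finset ℕ} {K R : ℕ} (hT : T ⊆ range K)
    (h : ∀ a ∈ T, ∀ b ∈ T, a ≡ b [MOD R]) : #T ≤ K / R + 1 := by
  have hinj : Set.InjOn (fun a : ℕ => a / R) T := by
    intro a ha b hb hab
    have h1 : a % R = b % R := h a ha b hb
    have h2 : a / R = b / R := hab
    rw [← Nat.div_add_mod a R, ← Nat.div_add_mod b R, h1, h2]
  rw [← card_image_of_injOn hinj, ← card_range (K / R + 1)]
  refine card_le_card fun a ha => ?_
  obtain ⟨k, hk, rfl⟩ := mem_image.1 ha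
  have := Nat.div_le_div_right (c := R) (mem_range.1 (hT hk)).le
  exact mem_range.2 (by omega)

open Finset in
theorem card_filter_testBit_le {u l r : ℕ} (hr : l ≤ r) (s : ℕ → Bool) (K : ℕ) :
    #{k ∈ range K | ∀ i < r, (2 ^ l * k + u).testBit i = s i} ≤ K / 2 ^ (r - l) + 1 := by
  refine card_le_div_add_one_of_modEq (filter_subset _ _) fun a ha b hb => ?_
  have h : 2 ^ l * a + u ≡ 2 ^ l * b + u [MOD 2 ^ l * 2 ^ (r - l)] := by
    rw [← pow_add, Nat.add_sub_cancel' hr]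
    refine Nat.eq_of_testBit_eq fun i => ?_
    rw [Nat.testBit_mod_two_pow, Nat.testBit_mod_two_pow]
    by_cases hi : i < r
    · rw [(mem_filter.1 ha).2 i hi, (mem_filter.1 hb).2 i hi]
    · simp [hi]
  exact Nat.ModEq.mul_left_cancel' (by positivity) (Nat.ModEq.add_right_cancel' u h)

open Finset in
theorem sum_div_two_pow_le (K N N' l : ℕ) (hl : l ≤ N) :
    4 * ∑ n ∈ Ico N N', K / 2 ^ (n + 3 - l) ≤ K := by
  have key : ∀ d, 4 * ∑ n ∈ range d, K / 2 ^ (n + 3) + K / 2 ^ d ≤ K := by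
    intro d
    induction d with
    | zero => simp
    | succ d ih =>
      rw [sum_range_succ]
      have h1 : K / 2 ^ (d + 3) = K / 2 ^ d / 8 := by rw [pow_add, Nat.div_div_eq_div_mul]; rfl
      have h2 : K / 2 ^ (d + 1) = K / 2 ^ d / 2 := by rw [pow_add, Nat.div_div_eq_div_mul]; rfl
      omega
  rw [sum_Ico_eq_sum_range]
  refine le_trans (Nat.mul_le_mul_left 4 (sum_le_sum fun n _ => ?_)) (le_of_add_le_left (key (N' - N)))
  exact Nat.div_le_div_left (Nat.pow_le_pow_right (by norm_num) (by omega)) (by positivity)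

open Finset Classical in
/-- One step of the fusion: inside the cylinder coded by `(u, l)` there is a cylinder coded by
`(u', l')` avoiding all cylinders `(s n, n + 3)` with `n ∈ A`, `n < N'`. -/
theorem exists_cylinder_extension {A : Set ℕ}
    (hA : ∀ q N₀, ∃ n ≥ N₀, q * #{i ∈ range n | i ∈ A} < n) (s : ℕ → ℕ → Bool)
    {u l N : ℕ} (hu : u < 2 ^ l) (hl : l ≤ N)
    (h : ∀ n ∈ A, n < N → ∀ x : ℕ → Bool, (∀ i < l, x i = u.testBit i) →
      ¬ ∀ i < n + 3, x i = s n i) (m : ℕ) :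
    ∃ u' l' N', u' < 2 ^ l' ∧ l' ≤ N' ∧
      (∀ n ∈ A, n < N' → ∀ x : ℕ → Bool, (∀ i < l', x i = u'.testBit i) →
        ¬ ∀ i < n + 3, x i = s n i) ∧
      l < l' ∧ N < N' ∧ (∀ i < l, u'.testBit i = u.testBit i) ∧ m * (u' + 1) ≤ l' := by
  set C := (m + 1) * 2 ^ l with hC
  have hCpos : 0 < C := by positivity
  obtain ⟨N', hN', hq⟩ := hA (8 * C) (N + 1 + C)
  set K := N' / C with hK
  have hKpos : 0 < K := Nat.div_pos (by omega) hCpos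
  have hN'lt : N' < 2 * (C * K) := by
    have h1 := Nat.lt_mul_div_succ N' hCpos
    have h2 : C * 1 ≤ C * K := Nat.mul_le_mul_left C hKpos
    rw [← hK, mul_add] at h1
    omega
  have hle : C * K ≤ N' := Nat.mul_div_le N' C
  have hcard : 4 * #{i ∈ range N' | i ∈ A} < K := by
    have : C * (4 * #{i ∈ range N' | i ∈ A}) < C * K := by
      nlinarith
    exact lt_of_mul_lt_mul_left this (Nat.zero_le _)
  have hKl : 2 ^ l * K ≤ C * K := by
    rw [hC]; exact Nat.mul_le_mul_right _ (Nat.le_mul_of_pos_left _ (by omega))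
  have hlt : l < C * K :=
    lt_of_lt_of_le Nat.lt_two_pow_self (le_trans (Nat.le_mul_of_pos_right _ hKpos) hKl)
  have hKsmall : K < 2 ^ (C * K - l) := by
    have h1 : 2 ^ l * K < 2 ^ l * 2 ^ (C * K - l) := by
      rw [← pow_add, Nat.add_sub_cancel' hlt.le]
      exact lt_of_le_of_lt hKl Nat.lt_two_pow_self
    exact lt_of_mul_lt_mul_left h1 (Nat.zero_le _)
  let B : ℕ → Finset ℕ := fun n =>
    {k ∈ range K | ∀ i < min (n + 3) (C * K), (2 ^ l * k + u).testBit i = s n i}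
  have hB : ∀ n ∈ Ico N N', #(B n) ≤ K / 2 ^ (n + 3 - l) + 1 := by
    intro n hn
    have hn := mem_Ico.1 hn
    refine (card_filter_testBit_le (by omega) (s n) K).trans ?_
    rcases le_total (n + 3) (C * K) with h1 | h1
    · rw [min_eq_left h1]
    · rw [min_eq_right h1, Nat.div_eq_of_lt hKsmall, Nat.zero_add]
      exact Nat.le_add_left _ _
  have hunion : #({n ∈ Ico N N' | n ∈ A}.biUnion B) < K := by
    calc #({n ∈ Ico N N' | n ∈ A}.biUnion B)
        ≤ ∑ n ∈ Ico N N' with n ∈ A, #(B n) := card_biUnion_le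
      _ ≤ ∑ n ∈ Ico N N' with n ∈ A, (K / 2 ^ (n + 3 - l) + 1) :=
          sum_le_sum fun n hn => hB n (mem_filter.1 hn).1
      _ = (∑ n ∈ Ico N N' with n ∈ A, K / 2 ^ (n + 3 - l)) + #{n ∈ Ico N N' | n ∈ A} := by
          rw [sum_add_distrib, card_eq_sum_ones]
      _ ≤ (∑ n ∈ Ico N N', K / 2 ^ (n + 3 - l)) + #{i ∈ range N' | i ∈ A} := by
          refine add_le_add (sum_le_sum_of_subset (filter_subset _ _)) (card_le_card ?_)
          exact filter_subset_filter _ fun n hn => mem_range.2 (mem_Ico.1 hn).2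
      _ < K := by
          have := sum_div_two_pow_le K N N' l hl
          omega
  obtain ⟨k, hk, hkB⟩ := exists_mem_notMem_of_card_lt_card (hunion.trans_eq (card_range K).symm)
  have huk : 2 ^ l * k + u < 2 ^ l * K := by
    have : 2 ^ l * (k + 1) ≤ 2 ^ l * K := Nat.mul_le_mul_left _ (mem_range.1 hk)
    rw [mul_add] at this
    omega
  have hbit : ∀ i < l, (2 ^ l * k + u).testBit i = u.testBit i := fun i hi => by
    rw [Nat.testBit_two_pow_mul_add _ hu, if_pos hi]
  refine ⟨2 ^ l * k + u, C * K, N', (huk.trans_le hKl).trans Nat.lt_two_pow_self, hle, ?_, hlt,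
    by omega, hbit, ?_⟩
  · intro n hnA hn x hx hxs
    rcases lt_or_ge n N with hnN | hnN
    · exact h n hnA hnN x (fun i hi => (hx i (hi.trans hlt)).trans (hbit i hi)) hxs
    · refine hkB (mem_biUnion.2 ⟨n, mem_filter.2 ⟨mem_Ico.2 ⟨hnN, hn⟩, hnA⟩,
        mem_filter.2 ⟨hk, fun i hi => ?_⟩⟩)
      rw [lt_min_iff] at hi
      rw [← hx i hi.2, hxs i hi.1]
  · calc m * (2 ^ l * k + u + 1) ≤ (m + 1) * (2 ^ l * K) := Nat.mul_le_mul (by omega) huk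
      _ = C * K := by rw [hC, mul_assoc]

/-- The binary sequences which are, for every `m`, approximated by some natural number `k` (read as
a binary sequence) on their first `m * (k + 1)` digits. -/
def superApproximable : Set (ℕ → Bool) :=
  {x | ∀ m, ∃ k : ℕ, ∀ i < m * (k + 1), x i = k.testBit i}

open Finset Classical in
/-- The index set of a fast shrinking cover of `superApproximable` by cylinders has positive lower
density. -/
theorem exists_le_mul_card_of_cover {A : Set ℕ} (s : ℕ → ℕ → Bool)
    (hcov : ∀ x ∈ superApproximable, ∃ n ∈ A, ∀ i < n + 3, x i = s n i) :
    ∃ q N₀, ∀ n ≥ N₀, n ≤ q * #{i ∈ range n | i ∈ A} := by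
  by_contra! hA
  let P : ℕ × ℕ × ℕ → Prop := fun p => p.1 < 2 ^ p.2.1 ∧ p.2.1 ≤ p.2.2 ∧
    ∀ n ∈ A, n < p.2.2 → ∀ x : ℕ → Bool, (∀ i < p.2.1, x i = p.1.testBit i) →
      ¬ ∀ i < n + 3, x i = s n i
  have step : ∀ (m : ℕ) (p : {p // P p}), ∃ p' : {p // P p}, p.1.2.1 < p'.1.2.1 ∧
      p.1.2.2 < p'.1.2.2 ∧ (∀ i < p.1.2.1, p'.1.1.testBit i = p.1.1.testBit i) ∧
      m * (p'.1.1 + 1) ≤ p'.1.2.1 := by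
    rintro m ⟨⟨u, l, N⟩, h1, h2, h3⟩
    obtain ⟨u', l', N', h1', h2', h3', h⟩ := exists_cylinder_extension hA s h1 h2 h3 m
    exact ⟨⟨⟨u', l', N'⟩, h1', h2', h3'⟩, h⟩
  choose f hfl hfN hfu hfm using step
  let p : ℕ → {p // P p} := fun n =>
    Nat.rec ⟨(0, 0, 0), by simp, by simp, by simp⟩ (fun m q => f m q) n
  have hl : StrictMono fun m => (p m).1.2.1 := strictMono_nat_of_lt_succ fun m => hfl m (p m)
  have hN : StrictMono fun m => (p m).1.2.2 := strictMono_nat_of_lt_succ fun m => hfN m (p m)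
  have hu : ∀ m m', m ≤ m' → ∀ i < (p m).1.2.1, (p m').1.1.testBit i = (p m).1.1.testBit i := by
    intro m m' hm
    induction m', hm using Nat.le_induction with
    | base => simp
    | succ m' hm ih =>
      intro i hi
      exact (hfu m' (p m') i (hi.trans_le (hl.monotone hm))).trans (ih i hi)
  let x : ℕ → Bool := fun i => (p (i + 1)).1.1.testBit i
  have hx : ∀ m, ∀ i < (p m).1.2.1, x i = (p m).1.1.testBit i := by
    intro m i hi
    rcases le_total m (i + 1) with hm | hm
    · exact hu m _ hm i hi
    · exact (hu _ m hm i (hl.le_apply (x := i + 1))).symm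
  obtain ⟨n, hnA, hn⟩ := hcov x fun m =>
    ⟨(p (m + 1)).1.1, fun i hi => hx (m + 1) i (hi.trans_le (hfm m (p m)))⟩
  exact (p (n + 1)).2.2.2 n hnA (hN.le_apply (x := n + 1)) x (hx (n + 1)) hn

/-- The base `8` digits `4 c i + 2 x i`. -/
def pairDigits (c x : ℕ → Bool) (i : ℕ) : Fin 8 :=
  ⟨4 * (c i).toNat + 2 * (x i).toNat, by cases c i <;> cases x i <;> decide⟩

theorem two_le_abs_pairDigits_sub {c d x y : ℕ → Bool} {i : ℕ} (h : ¬ (c i = d i ∧ x i = y i)) :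
    (2 : ℝ) ≤ |((pairDigits c x i : ℕ) : ℝ) - (pairDigits d y i : ℕ)| := by
  have : (2 : ℤ) ≤ |((pairDigits c x i : ℕ) : ℤ) - (pairDigits d y i : ℕ)| := by
    revert h
    simp only [pairDigits]
    cases c i <;> cases d i <;> cases x i <;> cases y i <;> decide
  exact_mod_cast this

theorem inv_pow_le_abs_ofDigits_sub {b : ℕ} {d e : ℕ → Fin b} {i : ℕ} (hlt : ∀ j < i, d j = e j)
    (hi : (2 : ℝ) ≤ |((d i : ℕ) : ℝ) - (e i : ℕ)|) :
    ((b : ℝ) ^ (i + 1))⁻¹ ≤ |Real.ofDigits d - Real.ofDigits e| := by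
  rw [Real.ofDigits_eq_sum_add_ofDigits d (i + 1), Real.ofDigits_eq_sum_add_ofDigits e (i + 1),
    Finset.sum_range_succ, Finset.sum_range_succ]
  have hs : ∑ j ∈ Finset.range i, Real.ofDigitsTerm d j =
      ∑ j ∈ Finset.range i, Real.ofDigitsTerm e j :=
    Finset.sum_congr rfl fun j hj => by
      simp [Real.ofDigitsTerm, hlt j (Finset.mem_range.1 hj)]
  rw [hs]
  simp only [Real.ofDigitsTerm]
  set t := Real.ofDigits fun j => d (j + (i + 1))
  set t' := Real.ofDigits fun j => e (j + (i + 1))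
  have ht : |t' - t| ≤ 1 := by
    have h0 : 0 ≤ t := Real.ofDigits_nonneg _
    have h1 : t ≤ 1 := Real.ofDigits_le_one _
    have h0' : 0 ≤ t' := Real.ofDigits_nonneg _
    have h1' : t' ≤ 1 := Real.ofDigits_le_one _
    rw [abs_le]
    constructor <;> linarith
  set w := ((b : ℝ) ^ (i + 1))⁻¹
  have hw : 0 ≤ w := by positivity
  have heq : (∑ j ∈ Finset.range i, ((e j : ℕ) : ℝ) * ((b : ℝ) ^ (j + 1))⁻¹) + (d i : ℕ) * w + w * t -
      ((∑ j ∈ Finset.range i, ((e j : ℕ) : ℝ) * ((b : ℝ) ^ (j + 1))⁻¹) + (e i : ℕ) * w + w * t') =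
      w * ((((d i : ℕ) : ℝ) - (e i : ℕ)) - (t' - t)) := by ring
  rw [heq, abs_mul, abs_of_nonneg hw]
  refine le_mul_of_one_le_right hw ?_
  have := abs_sub_abs_le_abs_sub (((d i : ℕ) : ℝ) - (e i : ℕ)) (t' - t)
  linarith

theorem agree_of_abs_ofDigits_pairDigits_sub_le {c d x y : ℕ → Bool} {n : ℕ}
    (h : |Real.ofDigits (pairDigits c x) - Real.ofDigits (pairDigits d y)| ≤ ((8 : ℝ) ^ (n + 1))⁻¹)
    (i : ℕ) (hi : i < n) : c i = d i ∧ x i = y i := by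
  induction i using Nat.strong_induction_on with
  | _ i ih =>
    by_contra hne
    have h1 := inv_pow_le_abs_ofDigits_sub (d := pairDigits c x) (e := pairDigits d y)
      (fun j hj => by simp [pairDigits, ih j hj (hj.trans hi)]) (two_le_abs_pairDigits_sub hne)
    have h2 : ((8 : ℝ) ^ (n + 1))⁻¹ < ((8 : ℝ) ^ (i + 1))⁻¹ := by
      gcongr
      norm_num
    push_cast at h1
    linarith

theorem Microscopic.image_superApproximable (c : ℕ → Bool) :
    Microscopic ((fun x => Real.ofDigits (pairDigits c x)) '' superApproximable) := by
  intro ε hε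
  obtain ⟨m, hm⟩ := exists_pow_lt_of_lt_one (half_pos hε) (show (8⁻¹ : ℝ) < 1 by norm_num)
  let r : ℕ → ℝ := fun k => (((8 : ℕ) : ℝ) ^ (m * (k + 1)))⁻¹
  let z : ℕ → ℝ := fun k => Real.ofDigits (pairDigits c k.testBit)
  refine ⟨fun k => Set.Icc (z k - r k) (z k + r k), fun k => Set.ordConnected_Icc, ?_, fun k => ?_⟩
  · rintro _ ⟨x, hx, rfl⟩
    obtain ⟨k, hk⟩ := hx m
    have := abs_le.1 (Real.abs_ofDigits_sub_ofDigits_le (x := pairDigits c x)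
      (y := pairDigits c k.testBit) (n := m * (k + 1)) fun i hi => by simp [pairDigits, hk i hi])
    exact Set.mem_iUnion.2 ⟨k, by simp only [Set.mem_Icc, z, r]; constructor <;> linarith⟩
  · rw [Real.volume_Icc]
    refine ENNReal.ofReal_le_ofReal ?_
    have h1 : r k ≤ (ε / 2) ^ (k + 1) := by
      have : r k = ((8⁻¹ : ℝ) ^ m) ^ (k + 1) := by simp only [r]; rw [← pow_mul, inv_pow]; norm_num
      rw [this]
      exact pow_le_pow_left₀ (by positivity) hm.le _
    have h2 : 2 * (ε / 2) ^ (k + 1) ≤ ε ^ (k + 1) := by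
      rw [div_pow, pow_succ (2 : ℝ)]
      have : ε ^ (k + 1) / 2 ^ k ≤ ε ^ (k + 1) :=
        div_le_self (by positivity) (one_le_pow₀ (by norm_num))
      calc 2 * (ε ^ (k + 1) / (2 ^ k * 2)) = ε ^ (k + 1) / 2 ^ k := by field_simp
        _ ≤ _ := this
    linarith

theorem IsIntervalSet.abs_sub_le_s7 {J : Set ℝ} (hJ : IsIntervalSet J) {δ : ℝ} (hδ : 0 ≤ δ)
    (hvol : volume J ≤ ENNReal.ofReal δ) {p q : ℝ} (hp : p ∈ J) (hq : q ∈ J) : |p - q| ≤ δ := by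
  wlog hpq : p ≤ q generalizing p q
  · rw [abs_sub_comm]
    exact this hq hp (le_of_not_ge hpq)
  have h := (measure_mono (μ := volume) (Set.OrdConnected.out hJ hp hq)).trans hvol
  rw [Real.volume_Icc, ENNReal.ofReal_le_ofReal_iff hδ] at h
  rw [abs_sub_comm, abs_of_nonneg (sub_nonneg.2 hpq)]
  exact h

theorem exists_infinite_fiber_of_countable {ι κ : Type*} [Uncountable ι] [Countable κ]
    (f : ι → κ) : ∃ k, (f ⁻¹' {k}).Infinite := by
  by_contra! h
  refine Set.not_countable_univ (α := ι) ?_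
  have : (Set.univ : Set ι) = ⋃ k, f ⁻¹' {k} := by ext; simp
  rw [this]
  exact Set.countable_iUnion fun k => (h k).countable

open Finset Classical in
/-- Uncountably many sets of positive lower density cannot be pairwise almost disjoint. -/
theorem not_pairwise_almost_disjoint {ι : Type*} [Uncountable ι] (A : ι → Set ℕ)
    (hA : ∀ α, ∃ q N₀, ∀ n ≥ N₀, n ≤ q * #{i ∈ range n | i ∈ A α})
    (hdisj : ∀ α β, α ≠ β → ∃ D, ∀ n ≥ D, n ∈ A α → n ∉ A β) : False := by
  choose q N₀ hqN using hA
  obtain ⟨⟨Q, M⟩, hinf⟩ := exists_infinite_fiber_of_countable fun α => (q α, N₀ α)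
  obtain ⟨F, hF, hFcard⟩ := hinf.exists_subset_card_eq (Q + 1)
  have hF' : ∀ α ∈ F, ∀ n ≥ M, n ≤ Q * #{i ∈ range n | i ∈ A α} := by
    intro α hα
    have h := hF hα
    simp only [Set.mem_preimage, Set.mem_singleton_iff, Prod.mk.injEq] at h
    obtain ⟨rfl, rfl⟩ := h
    exact hqN α
  have hdisj' : ∀ α β, ∃ D, α ≠ β → ∀ n ≥ D, n ∈ A α → n ∉ A β := by
    intro α β
    by_cases h : α = β
    · exact ⟨0, fun h' => absurd h h'⟩
    · obtain ⟨D, hD⟩ := hdisj α β h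
      exact ⟨D, fun _ => hD⟩
  choose D hD using hdisj'
  let E := F.sup fun α => F.sup fun β => D α β
  have hE : ∀ α ∈ F, ∀ β ∈ F, D α β ≤ E := fun α hα β hβ =>
    (le_sup (f := fun β => D α β) hβ).trans (le_sup (f := fun α => F.sup fun β => D α β) hα)
  let n := M + E + Q * (Q + 1) * E + 1
  have hsum : ∑ α ∈ F, #{i ∈ Ico E n | i ∈ A α} ≤ n := by
    rw [← card_biUnion]
    · calc _ ≤ #(range n) := card_le_card fun i hi => by
            obtain ⟨α, -, hi⟩ := mem_biUnion.1 hi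
            exact mem_range.2 (mem_Ico.1 (mem_filter.1 hi).1).2
        _ = n := card_range n
    · intro α hα β hβ hne
      refine disjoint_left.2 fun i hi hi' => ?_
      obtain ⟨h1, h2⟩ := mem_filter.1 hi
      exact hD α β hne i ((hE α hα β hβ).trans (mem_Ico.1 h1).1) h2 (mem_filter.1 hi').2
  have hsplit : ∀ α ∈ F, n ≤ Q * (#{i ∈ Ico E n | i ∈ A α} + E) := by
    intro α hα
    refine (hF' α hα n (by simp only [n]; omega)).trans (Nat.mul_le_mul_left _ ?_)
    have hsub : ({i ∈ range n | i ∈ A α} : Finset ℕ) ⊆ {i ∈ Ico E n | i ∈ A α} ∪ range E := by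
      intro i hi
      simp only [mem_filter, mem_range, mem_union, mem_Ico] at hi ⊢
      rcases lt_or_ge i E with h | h
      · exact Or.inr h
      · exact Or.inl ⟨⟨h, hi.1⟩, hi.2⟩
    calc _ ≤ _ := card_le_card hsub
      _ ≤ _ := card_union_le _ _
      _ = _ := by rw [card_range]
  have htotal := sum_le_sum hsplit
  rw [sum_const, smul_eq_mul, ← mul_sum, sum_add_distrib, sum_const, smul_eq_mul, hFcard] at htotal
  have h1 : Q * (∑ α ∈ F, #{i ∈ Ico E n | i ∈ A α} + (Q + 1) * E) ≤ Q * (n + (Q + 1) * E) :=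
    Nat.mul_le_mul_left _ (by omega)
  have h2 : n ≤ Q * (Q + 1) * E := by nlinarith
  simp only [n] at h2
  omega

theorem not_microscopic_iUnion_image {ι : Type*} [Uncountable ι] {c : ι → ℕ → Bool}
    (hc : Function.Injective c) :
    ¬ Microscopic
      (⋃ α, (fun x => Real.ofDigits (pairDigits (c α) x)) '' superApproximable) := by
  intro h
  obtain ⟨J, hJ, hcov, hvol⟩ := h ((8 : ℝ) ^ 4)⁻¹ (by positivity)
  have hagree : ∀ n c d x y, Real.ofDigits (pairDigits c x) ∈ J n →
      Real.ofDigits (pairDigits d y) ∈ J n → ∀ i < n + 3, c i = d i ∧ x i = y i := by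
    intro n c d x y hx hy
    refine agree_of_abs_ofDigits_pairDigits_sub_le ?_
    refine ((hJ n).abs_sub_le_s7 (by positivity) (hvol n) hx hy).trans ?_
    rw [inv_pow, ← pow_mul]
    gcongr
    · norm_num
    · omega
  let A : ι → Set ℕ := fun α => {n | ∃ x, Real.ofDigits (pairDigits (c α) x) ∈ J n}
  refine not_pairwise_almost_disjoint A (fun α => ?_) fun α β hne => ?_
  · have hs : ∀ n, ∃ s : ℕ → Bool, n ∈ A α → Real.ofDigits (pairDigits (c α) s) ∈ J n := by
      intro n
      by_cases hn : n ∈ A α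
      · exact hn.imp fun s hs _ => hs
      · exact ⟨fun _ => false, fun h' => absurd h' hn⟩
    choose s hs using hs
    refine exists_le_mul_card_of_cover s fun x hx => ?_
    obtain ⟨n, hn⟩ := Set.mem_iUnion.1 (hcov (Set.mem_iUnion.2 ⟨α, x, hx, rfl⟩))
    exact ⟨n, ⟨x, hn⟩, fun i hi => (hagree n _ _ _ _ hn (hs n ⟨x, hn⟩) i hi).2⟩
  · obtain ⟨i, hi⟩ := Function.ne_iff.1 (hc.ne hne)
    refine ⟨i, ?_⟩
    rintro n hn ⟨x, hx⟩ ⟨y, hy⟩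
    exact hi (hagree n _ _ _ _ hx hy i (by omega)).1

open Cardinal in
theorem mk_lt_ord_aleph_one :
    #{o : Ordinal.{u} // o < (Cardinal.aleph 1).ord} = ℵ₁ :=
  (Cardinal.mk_Iio_ordinal (Cardinal.aleph.{u} 1).ord).trans (by rw [card_ord]; simp)

theorem exists_omega1_family_of_microscopic_sets :
    ∃ X : {o : Ordinal // o < (Cardinal.aleph 1).ord} → Set ℝ,
      (∀ α, Microscopic (X α)) ∧ ¬ Microscopic (⋃ α, X α) := by
  have hunc : Uncountable {o : Ordinal // o < (Cardinal.aleph 1).ord} := by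
    rw [← Cardinal.aleph0_lt_mk_iff, mk_lt_ord_aleph_one]
    exact Cardinal.aleph0_lt_aleph_one
  have hle : Cardinal.lift.{0} (Cardinal.mk {o : Ordinal // o < (Cardinal.aleph 1).ord}) ≤
      Cardinal.lift (Cardinal.mk (ℕ → Bool)) := by
    rw [mk_lt_ord_aleph_one]
    simpa using Cardinal.aleph_one_le_continuum
  obtain ⟨c⟩ := Cardinal.lift_mk_le'.1 hle
  exact ⟨fun α => (fun x => Real.ofDigits (pairDigits (c α) x)) '' superApproximable,
    fun α => Microscopic.image_superApproximable (c α), not_microscopic_iUnion_image c.injective⟩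
end

section
/- Assume MA_κ. If 𝓕 is a family of sets in 𝓜' with card(𝓕) ≤ κ, then ⋃𝓕 belongs to 𝓜'. -/
open MeasureTheory Filter

/-- Martin's axiom for the cardinal `κ`. -/
def MartinsAxiom (κ : Cardinal) : Prop :=
  ∀ (P : Type) [PartialOrder P], Nonempty P →
    (∀ A : Set P, (∀ p ∈ A, ∀ q ∈ A, p ≠ q → ¬∃ r : P, r ≤ p ∧ r ≤ q) → A.Countable) →
    ∀ 𝓓 : Set (Set P), Cardinal.mk ↥𝓓 ≤ κ →
      (∀ D ∈ 𝓓, ∀ p : P, ∃ q ∈ D, q ≤ p) →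
      ∃ G : Set P,
        (∀ p ∈ G, ∀ q : P, p ≤ q → q ∈ G) ∧
        (∀ p ∈ G, ∀ q ∈ G, ∃ r ∈ G, r ≤ p ∧ r ≤ q) ∧
        ∀ D ∈ 𝓓, (G ∩ D).Nonempty

/-- The members of `E` whose label (third coordinate) is at most `j`. -/
def labelLE (E : Set (ℚ × ℚ × ℕ)) (j : ℕ) : Set (ℚ × ℚ × ℕ) := {x ∈ E | x.2.2 ≤ j}

/-- The union of the rational open intervals coded by the members of `E`. -/
def codedUnion (E : Set (ℚ × ℚ × ℕ)) : Set ℝ := ⋃ x ∈ E, Set.Ioo (x.1 : ℝ) (x.2.1 : ℝ)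

/-- Every interval coded in `E` with label `d` has length at most `δ ^ (d + 1)`. -/
def ShortCodes (δ : ℝ) (E : Set (ℚ × ℚ × ℕ)) : Prop :=
  ∀ x ∈ E, (x.2.1 : ℝ) - x.1 ≤ δ ^ (x.2.2 + 1)

/-- The labels of `E`, counted with multiplicity, have asymptotic density zero. -/
structure ThinLabels (E : Set (ℚ × ℚ × ℕ)) : Prop where
  finite : ∀ j, (labelLE E j).Finite
  eventually_le : ∀ k : ℕ, ∃ n : ℕ, ∀ j ≥ n, k * (labelLE E j).ncard ≤ j + 1

lemma labelLE_mono {E F : Set (ℚ × ℚ × ℕ)} (h : E ⊆ F) (j : ℕ) : labelLE E j ⊆ labelLE F j :=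
  fun _ hx => ⟨h hx.1, hx.2⟩

lemma labelLE_union (E F : Set (ℚ × ℚ × ℕ)) (j : ℕ) :
    labelLE (E ∪ F) j = labelLE E j ∪ labelLE F j := by
  ext x
  simp only [labelLE, Set.mem_union, Set.mem_ofPred_eq]
  tauto

lemma ncard_labelLE_union_le (E F : Set (ℚ × ℚ × ℕ)) (j : ℕ) :
    (labelLE (E ∪ F) j).ncard ≤ (labelLE E j).ncard + (labelLE F j).ncard := by
  rw [labelLE_union]
  exact Set.ncard_union_le _ _

lemma ThinLabels.union {E F : Set (ℚ × ℚ × ℕ)} (hE : ThinLabels E) (hF : ThinLabels F) :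
    ThinLabels (E ∪ F) where
  finite j := by
    rw [labelLE_union]
    exact (hE.finite j).union (hF.finite j)
  eventually_le k := by
    obtain ⟨n, hn⟩ := hE.eventually_le (2 * k)
    obtain ⟨m, hm⟩ := hF.eventually_le (2 * k)
    refine ⟨max n m, fun j hj => ?_⟩
    have h1 := hn j (le_trans (le_max_left _ _) hj)
    have h2 := hm j (le_trans (le_max_right _ _) hj)
    have h3 := Nat.mul_le_mul_left k (ncard_labelLE_union_le E F j)
    linarith

lemma labelLE_empty (j : ℕ) : labelLE ∅ j = ∅ := by
  simp [labelLE]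

lemma thinLabels_empty : ThinLabels ∅ where
  finite j := by simp [labelLE_empty]
  eventually_le k := ⟨0, fun j _ => by simp [labelLE_empty]⟩

lemma codedUnion_mono {E F : Set (ℚ × ℚ × ℕ)} (h : E ⊆ F) : codedUnion E ⊆ codedUnion F :=
  Set.biUnion_subset_biUnion_left h

/-- An interval of measure less than `L` lies in a rational open interval of length at most `L`. -/
lemma exists_rat_Ioo_of_volume_le {S : Set ℝ} (hS : IsIntervalSet S) {v L : ℝ} (hv : 0 ≤ v)
    (hvL : v < L) (hvol : volume S ≤ ENNReal.ofReal v) :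
    ∃ a b : ℚ, S ⊆ Set.Ioo (a : ℝ) b ∧ (b : ℝ) - a ≤ L := by
  rcases S.eq_empty_or_nonempty with rfl | ⟨z, hz⟩
  · exact ⟨0, 0, Set.empty_subset _, by push_cast; linarith⟩
  have key : ∀ x ∈ S, ∀ y ∈ S, y - x ≤ v := by
    intro x hx y hy
    have h := (measure_mono (hS.out hx hy)).trans hvol
    rw [Real.volume_Icc] at h
    exact (ENNReal.ofReal_le_ofReal_iff hv).1 h
  have hne : S.Nonempty := ⟨z, hz⟩
  have hba : BddAbove S := ⟨z + v, fun y hy => by linarith [key z hz y hy]⟩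
  have hbb : BddBelow S := ⟨z - v, fun y hy => by linarith [key y hy z hz]⟩
  have hdiff : sSup S - sInf S ≤ v := by
    have : sSup S ≤ v + sInf S := by
      refine csSup_le hne fun y hy => ?_
      have : y - v ≤ sInf S := le_csInf hne fun x hx => by linarith [key x hx y hy]
      linarith
    linarith
  obtain ⟨a, ha1, ha2⟩ := exists_rat_btwn (show sInf S - (L - v) / 2 < sInf S by linarith)
  obtain ⟨b, hb1, hb2⟩ := exists_rat_btwn (show sSup S < sSup S + (L - v) / 2 by linarith)
  exact ⟨a, b, fun x hx => ⟨ha2.trans_le (csInf_le hbb hx), (le_csSup hba hx).trans_lt hb1⟩,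
    by linarith⟩

lemma DensityZero.eventually_mul_ncard_le {D : Set ℕ} (hD : DensityZero D) (k : ℕ) :
    ∃ n : ℕ, ∀ j ≥ n, k * (D ∩ Set.Iic j).ncard ≤ j + 1 := by
  have h := hD.eventually (gt_mem_nhds (show (0 : ℝ) < 1 / (k + 1) by positivity))
  obtain ⟨n, hn⟩ := eventually_atTop.1 h
  refine ⟨n, fun j hj => ?_⟩
  have h1 := hn j hj
  rw [div_lt_div_iff₀ (by positivity) (by positivity)] at h1
  have h2 : ((k * (D ∩ Set.Iic j).ncard : ℕ) : ℝ) ≤ ((j + 1 : ℕ) : ℝ) := by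
    push_cast
    have : (0 : ℝ) ≤ ((D ∩ Set.Iic j).ncard : ℝ) := by positivity
    nlinarith
  exact_mod_cast h2

/-- A set in `𝓜'` has thin coded covers with arbitrarily large labels and small counts. -/
lemma MPrime.exists_thinLabels {M : Set ℝ} (hM : MPrime M) {δ : ℝ} (hδ : 0 < δ) (n k : ℕ) :
    ∃ E, ShortCodes δ E ∧ ThinLabels E ∧ (∀ x ∈ E, n ≤ x.2.2) ∧
      (∀ j, k * (labelLE E j).ncard ≤ j + 1) ∧ M ⊆ codedUnion E := by
  set N := n + k + 1 with hN
  obtain ⟨D, hD, J, hJ, hcov, hvol⟩ := hM (δ ^ N / 2) (by positivity)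
  have hrat : ∀ d ∈ D, ∃ ab : ℚ × ℚ, J d ⊆ Set.Ioo (ab.1 : ℝ) ab.2 ∧
      (ab.2 : ℝ) - ab.1 ≤ δ ^ (N * (d + 1)) := by
    intro d hd
    obtain ⟨a, b, h1, h2⟩ := exists_rat_Ioo_of_volume_le (hJ d hd) (by positivity)
      (show (δ ^ N / 2) ^ (d + 1) < δ ^ (N * (d + 1)) by
        rw [pow_mul]
        have : 0 < δ ^ N := by positivity
        exact pow_lt_pow_left₀ (by linarith) (by positivity) (by omega)) (hvol d hd)
    exact ⟨(a, b), h1, h2⟩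
  choose! ab hab hlen using hrat
  let f : ℕ → ℚ × ℚ × ℕ := fun d => ((ab d).1, (ab d).2, N * (d + 1) - 1)
  have hpos : ∀ d, 1 ≤ N * (d + 1) := fun d => Nat.mul_pos (by omega) (by omega)
  have hsub1 : ∀ j, labelLE (f '' D) j ⊆ f '' (D ∩ Set.Iic j) := by
    rintro j _ ⟨⟨d, hd, rfl⟩, hj⟩
    refine ⟨d, ⟨hd, ?_⟩, rfl⟩
    change N * (d + 1) - 1 ≤ j at hj
    have : d + 1 ≤ N * (d + 1) := Nat.le_mul_of_pos_left _ (by omega)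
    simp only [Set.mem_Iic]
    omega
  have hsub2 : ∀ j, labelLE (f '' D) j ⊆ f '' (Set.Iio ((j + 1) / N)) := by
    rintro j _ ⟨⟨d, hd, rfl⟩, hj⟩
    refine ⟨d, ?_, rfl⟩
    change N * (d + 1) - 1 ≤ j at hj
    have := hpos d
    rw [Set.mem_Iio, ← Nat.succ_le_iff, Nat.le_div_iff_mul_le (by omega)]
    rw [mul_comm]
    simp only [Nat.succ_eq_add_one]
    omega
  refine ⟨f '' D, ?_, ⟨?_, ?_⟩, ?_, ?_, ?_⟩
  · rintro _ ⟨d, hd, rfl⟩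
    change ((ab d).2 : ℝ) - (ab d).1 ≤ δ ^ (N * (d + 1) - 1 + 1)
    rw [Nat.sub_add_cancel (hpos d)]
    exact hlen d hd
  · exact fun j => ((Set.finite_Iio _).image f).subset (hsub2 j)
  · intro l
    obtain ⟨m, hm⟩ := hD.eventually_mul_ncard_le l
    refine ⟨m, fun j hj => le_trans (Nat.mul_le_mul_left l ?_) (hm j hj)⟩
    have hfin : (D ∩ Set.Iic j).Finite := (Set.finite_Iic j).inter_of_right D
    exact (Set.ncard_le_ncard (hsub1 j) (hfin.image f)).trans (Set.ncard_image_le hfin)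
  · rintro _ ⟨d, hd, rfl⟩
    change n ≤ N * (d + 1) - 1
    have : N ≤ N * (d + 1) := Nat.le_mul_of_pos_right _ (by omega)
    omega
  · intro j
    have h1 : (labelLE (f '' D) j).ncard ≤ (j + 1) / N := by
      refine ((Set.ncard_le_ncard (hsub2 j) ((Set.finite_Iio _).image f)).trans
        (Set.ncard_image_le (Set.finite_Iio _))).trans ?_
      simp [Set.ncard_eq_toFinset_card']
    calc k * (labelLE (f '' D) j).ncard ≤ N * ((j + 1) / N) :=
          Nat.mul_le_mul (by omega) h1
      _ ≤ j + 1 := Nat.mul_div_le _ _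
  · intro x hx
    obtain ⟨d, hd, hxd⟩ := Set.mem_iUnion₂.1 (hcov hx)
    exact Set.mem_iUnion₂.2 ⟨f d, ⟨d, hd, rfl⟩, hab d hd hxd⟩

/-- Colliding labels of a thin coded cover can be separated at the cost of squaring `ε`. -/
lemma exists_densityZero_cover {ε : ℝ} (h0 : 0 < ε) (h1 : ε ≤ 1) {E : Set (ℚ × ℚ × ℕ)}
    (hshort : ShortCodes (ε ^ 2) E) (hthin : ThinLabels E)
    (hcount : ∀ j, (labelLE E j).ncard ≤ j + 1) :
    ∃ D : Set ℕ, DensityZero D ∧ ∃ J : ℕ → Set ℝ,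
      (∀ d ∈ D, IsIntervalSet (J d)) ∧ codedUnion E ⊆ (⋃ d ∈ D, J d) ∧
        ∀ d ∈ D, volume (J d) ≤ ENNReal.ofReal (ε ^ (d + 1)) := by
  let key : ℚ × ℚ × ℕ → ℕ ×ₗ ℕ := fun x => toLex (x.2.2, Encodable.encode x)
  have key_inj : Function.Injective key := by
    intro x y hxy
    have := congrArg (fun z => (ofLex z).2) hxy
    exact Encodable.encode_injective this
  have label_le : ∀ x y, key x ≤ key y → x.2.2 ≤ y.2.2 := by
    intro x y hxy
    rcases (Prod.Lex.toLex_le_toLex).1 hxy with h | h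
    · exact h.le
    · exact h.1.le
  let B : ℚ × ℚ × ℕ → Set (ℚ × ℚ × ℕ) := fun x => {y ∈ E | key y < key x}
  have hB : ∀ x, B x ⊆ labelLE E x.2.2 := fun x y hy => ⟨hy.1, label_le _ _ hy.2.le⟩
  have hBfin : ∀ x, (B x).Finite := fun x => (hthin.finite _).subset (hB x)
  let pos : ℚ × ℚ × ℕ → ℕ := fun x => x.2.2 + (B x).ncard
  have pos_lt : ∀ x ∈ E, ∀ y, key x < key y → pos x < pos y := by
    intro x hx y hxy
    have hss : B x ⊂ B y := by
      refine ⟨fun z hz => ⟨hz.1, hz.2.trans hxy⟩, fun h => ?_⟩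
      exact lt_irrefl _ (h (show x ∈ B y from ⟨hx, hxy⟩)).2
    exact add_lt_add_of_le_of_lt (label_le _ _ hxy.le) (Set.ncard_lt_ncard hss (hBfin y))
  have pos_inj : Set.InjOn pos E := by
    intro x hx y hy hxy
    rcases lt_trichotomy (key x) (key y) with h | h | h
    · exact absurd hxy (pos_lt x hx y h).ne
    · exact key_inj h
    · exact absurd hxy (pos_lt y hy x h).ne'
  have pos_le : ∀ x ∈ E, pos x + 1 ≤ 2 * (x.2.2 + 1) := by
    intro x hx
    have hlt : (B x).ncard < (labelLE E x.2.2).ncard := by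
      refine Set.ncard_lt_ncard ⟨hB x, fun h => ?_⟩ (hthin.finite _)
      exact lt_irrefl _ (h (show x ∈ labelLE E x.2.2 from ⟨hx, le_rfl⟩)).2
    have := hcount x.2.2
    change x.2.2 + (B x).ncard + 1 ≤ _
    omega
  have hinv := pos_inj.leftInvOn_invFunOn
  refine ⟨pos '' E, ?_, fun d => Set.Ioo ((Function.invFunOn pos E d).1 : ℝ)
    ((Function.invFunOn pos E d).2.1 : ℝ), fun _ _ => Set.ordConnected_Ioo, ?_, ?_⟩
  · have hcard : ∀ j, (pos '' E ∩ Set.Iic j).ncard ≤ (labelLE E j).ncard := by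
      intro j
      have hsub : pos '' E ∩ Set.Iic j ⊆ pos '' labelLE E j := by
        rintro _ ⟨⟨x, hx, rfl⟩, hj⟩
        exact ⟨x, ⟨hx, le_trans (Nat.le_add_right _ _) hj⟩, rfl⟩
      exact (Set.ncard_le_ncard hsub ((hthin.finite j).image _)).trans
        (Set.ncard_image_le (hthin.finite j))
    refine Metric.tendsto_atTop.2 fun r hr => ?_
    obtain ⟨k, hk⟩ := exists_nat_gt (1 / r)
    obtain ⟨n, hn⟩ := hthin.eventually_le k
    refine ⟨n, fun j hj => ?_⟩
    have hk0 : (0 : ℝ) < k := lt_trans (by positivity) hk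
    rw [Real.dist_eq, sub_zero, abs_of_nonneg (by positivity), div_lt_iff₀ (by positivity)]
    have h3 : (k : ℝ) * ((pos '' E ∩ Set.Iic j).ncard : ℝ) ≤ j + 1 := by
      exact_mod_cast (Nat.mul_le_mul_left k (hcard j)).trans (hn j hj)
    have h4 : 1 < r * k := by
      rw [div_lt_iff₀ hr] at hk
      linarith
    have hj0 : (0 : ℝ) < (j : ℝ) + 1 := by positivity
    refine lt_of_mul_lt_mul_left ?_ hk0.le
    nlinarith
  · intro t ht
    obtain ⟨x, hx, hxt⟩ := Set.mem_iUnion₂.1 ht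
    refine Set.mem_iUnion₂.2 ⟨pos x, ⟨x, hx, rfl⟩, ?_⟩
    simpa only [hinv hx] using hxt
  · rintro _ ⟨x, hx, rfl⟩
    simp only [hinv hx, Real.volume_Ioo]
    refine ENNReal.ofReal_le_ofReal ((hshort x hx).trans ?_)
    rw [← pow_mul]
    exact pow_le_pow_of_le_one h0.le h1 (pos_le x hx)

/-- A forcing condition: a thin set of coded intervals, frozen below the label `n`, together with
a promise that above `n` the final density stays below `1 / k`. -/
@[ext]
structure ThinCond (δ : ℝ) where
  E : Set (ℚ × ℚ × ℕ)
  n : ℕ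
  k : ℕ
  one_le_k : 1 ≤ k
  short : ShortCodes δ E
  thin : ThinLabels E
  count : ∀ j, (labelLE E j).ncard ≤ j + 1
  bound : ∀ j ≥ n, 2 * k * (labelLE E j).ncard ≤ j + 1

namespace ThinCond

variable {δ : ℝ}

/-- `q` extends `p`: it contains `p`, agrees with `p` below `p.n` and keeps the promise of `p`. -/
structure Extends (q p : ThinCond δ) : Prop where
  subset : p.E ⊆ q.E
  n_le : p.n ≤ q.n
  k_le : p.k ≤ q.k
  frozen : ∀ x ∈ q.E, x.2.2 < p.n → x ∈ p.E
  promise : ∀ j ≥ p.n, p.k * (labelLE q.E j).ncard ≤ j + 1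

instance : PartialOrder (ThinCond δ) where
  le := Extends
  le_refl p := ⟨subset_rfl, le_rfl, le_rfl, fun _ h _ => h, fun j hj => by
    have := p.bound j hj
    linarith [Nat.zero_le (p.k * (labelLE p.E j).ncard)]⟩
  le_trans r q p hrq hqp := ⟨hqp.subset.trans hrq.subset, hqp.n_le.trans hrq.n_le,
    hqp.k_le.trans hrq.k_le,
    fun x hx h => hqp.frozen x (hrq.frozen x hx (h.trans_le hqp.n_le)) h, fun j hj => by
      rcases lt_or_ge j q.n with h | h
      · have : labelLE r.E j ⊆ labelLE q.E j :=
          fun x hx => ⟨hrq.frozen x hx.1 (lt_of_le_of_lt hx.2 h), hx.2⟩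
        exact (Nat.mul_le_mul_left _ (Set.ncard_le_ncard this (q.thin.finite j))).trans
          (hqp.promise j hj)
      · exact (Nat.mul_le_mul_right _ hqp.k_le).trans (hrq.promise j h)⟩
  le_antisymm p q hpq hqp := ThinCond.ext (hqp.subset.antisymm hpq.subset)
    (hqp.n_le.antisymm hpq.n_le) (hqp.k_le.antisymm hpq.k_le)

instance : Nonempty (ThinCond δ) :=
  ⟨⟨∅, 0, 1, le_rfl, fun _ h => h.elim, thinLabels_empty, fun j => by simp [labelLE_empty],
    fun j _ => by simp [labelLE_empty]⟩⟩

lemma exists_le_union (p : ThinCond δ) {F : Set (ℚ × ℚ × ℕ)} (hshort : ShortCodes δ F)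
    (hthin : ThinLabels F) (hfrozen : ∀ x ∈ F, x.2.2 < p.n → x ∈ p.E)
    (hbound : ∀ j ≥ p.n, 2 * p.k * (labelLE F j).ncard ≤ j + 1) (m : ℕ) :
    ∃ q ≤ p, q.E = p.E ∪ F ∧ m ≤ q.k := by
  have hpromise : ∀ j ≥ p.n, p.k * (labelLE (p.E ∪ F) j).ncard ≤ j + 1 := by
    intro j hj
    have h1 := p.bound j hj
    have h2 := hbound j hj
    have h3 := Nat.mul_le_mul_left p.k (ncard_labelLE_union_le p.E F j)
    linarith
  have hfr : ∀ x ∈ p.E ∪ F, x.2.2 < p.n → x ∈ p.E :=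
    fun x hx h => hx.elim id fun hF => hfrozen x hF h
  have ht := p.thin.union hthin
  obtain ⟨n, hn⟩ := ht.eventually_le (2 * max p.k m)
  refine ⟨⟨p.E ∪ F, max p.n n, max p.k m, p.one_le_k.trans (le_max_left _ _),
    fun x hx => hx.elim (p.short x) (hshort x), ht, fun j => ?_,
    fun j hj => hn j ((le_max_right _ _).trans hj)⟩,
    ⟨Set.subset_union_left, le_max_left _ _, le_max_left _ _, hfr, hpromise⟩, rfl,
    le_max_right _ _⟩
  rcases lt_or_ge j p.n with h | h
  · have : labelLE (p.E ∪ F) j ⊆ labelLE p.E j :=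
      fun x hx => ⟨hfr x hx.1 (lt_of_le_of_lt hx.2 h), hx.2⟩
    exact (Set.ncard_le_ncard this (p.thin.finite j)).trans (p.count j)
  · exact (Nat.le_mul_of_pos_left _ p.one_le_k).trans (hpromise j h)

lemma exists_le_k (p : ThinCond δ) (m : ℕ) : ∃ q ≤ p, m ≤ q.k := by
  obtain ⟨q, hq, -, hm⟩ := p.exists_le_union (F := ∅) (fun _ h => h.elim) thinLabels_empty
    (fun _ h => h.elim) (fun j _ => by simp [labelLE_empty]) m
  exact ⟨q, hq, hm⟩

lemma exists_le_cover (hδ : 0 < δ) {M : Set ℝ} (hM : MPrime M) (p : ThinCond δ) :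
    ∃ q ≤ p, M ⊆ codedUnion q.E := by
  obtain ⟨F, hshort, hthin, hlabel, hcount, hcov⟩ := hM.exists_thinLabels hδ p.n (2 * p.k)
  obtain ⟨q, hq, hE, -⟩ := p.exists_le_union hshort hthin
    (fun x hx h => absurd (hlabel x hx) (not_le.2 h)) (fun j _ => hcount j) 0
  exact ⟨q, hq, hcov.trans (codedUnion_mono (hE ▸ Set.subset_union_right))⟩

lemma finite_frozen (p : ThinCond δ) : {x ∈ p.E | x.2.2 < p.n}.Finite :=
  (p.thin.finite p.n).subset fun _ hx => ⟨hx.1, hx.2.le⟩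

lemma exists_le_le_of_frozen_eq {p q : ThinCond δ} (hn : p.n = q.n) (hk : p.k = q.k)
    (hf : {x ∈ p.E | x.2.2 < p.n} = {x ∈ q.E | x.2.2 < q.n}) : ∃ r, r ≤ p ∧ r ≤ q := by
  obtain ⟨r, hr, hE, -⟩ := p.exists_le_union q.short q.thin
    (fun x hx h => (hf.symm.subset (⟨hx, hn ▸ h⟩ : x ∈ {x ∈ q.E | x.2.2 < q.n})).1)
    (fun j hj => by rw [hk]; exact q.bound j (hn ▸ hj)) 0
  refine ⟨r, hr, ⟨hE ▸ Set.subset_union_right, hn ▸ hr.n_le, hk ▸ hr.k_le, fun x hx h => ?_,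
    fun j hj => ?_⟩⟩
  · rw [← hn] at h
    exact (hf.subset (⟨hr.frozen x hx h, h⟩ : x ∈ {x ∈ p.E | x.2.2 < p.n})).1
  · rw [← hk]
    exact hr.promise j (hn ▸ hj)

lemma countable_of_antichain (A : Set (ThinCond δ))
    (hA : ∀ p ∈ A, ∀ q ∈ A, p ≠ q → ¬∃ r, r ≤ p ∧ r ≤ q) : A.Countable := by
  let f : ThinCond δ → ℕ × ℕ × Finset (ℚ × ℚ × ℕ) := fun p => (p.n, p.k, p.finite_frozen.toFinset)
  have hf : Set.InjOn f A := by
    intro p hp q hq hpq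
    by_contra hne
    simp only [f, Prod.mk.injEq, Set.Finite.toFinset_inj] at hpq
    exact hA p hp q hq hne (exists_le_le_of_frozen_eq hpq.1 hpq.2.1 hpq.2.2)
  exact (Set.mapsTo_univ f A).countable_of_injOn hf Set.countable_univ

lemma exists_cover_of_finite (hδ : 0 < δ) {𝓕 : Set (Set ℝ)} (hfin : 𝓕.Finite)
    (h𝓕 : ∀ M ∈ 𝓕, MPrime M) : ∃ p : ThinCond δ, ⋃₀ 𝓕 ⊆ codedUnion p.E := by
  induction 𝓕, hfin using Set.Finite.induction_on with
  | empty => exact ⟨Classical.arbitrary _, by simp⟩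
  | @insert M 𝓕 _ _ ih =>
    obtain ⟨p, hp⟩ := ih fun N hN => h𝓕 N (Set.mem_insert_of_mem _ hN)
    obtain ⟨q, hq, hM⟩ := exists_le_cover hδ (h𝓕 M (Set.mem_insert _ _)) p
    refine ⟨q, ?_⟩
    rw [Set.sUnion_insert]
    exact Set.union_subset hM (hp.trans (codedUnion_mono (Extends.subset hq)))

end ThinCond

section Generic

variable {δ : ℝ} {G : Set (ThinCond δ)}

lemma exists_mem_filter_subset (hG : ∀ p ∈ G, ∀ q ∈ G, ∃ r ∈ G, r ≤ p ∧ r ≤ q)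
    {p : ThinCond δ} (hp : p ∈ G) {S : Set (ℚ × ℚ × ℕ)} (hS : S.Finite)
    (hSG : S ⊆ ⋃ p ∈ G, p.E) : ∃ q ∈ G, q ≤ p ∧ S ⊆ q.E := by
  induction S, hS using Set.Finite.induction_on with
  | empty => exact ⟨p, hp, le_rfl, Set.empty_subset _⟩
  | @insert x S _ _ ih =>
    obtain ⟨q, hq, hqp, hSq⟩ := ih ((Set.subset_insert _ _).trans hSG)
    obtain ⟨p', hp', hx⟩ := Set.mem_iUnion₂.1 (hSG (Set.mem_insert _ _))
    obtain ⟨r, hr, hrq, hrp'⟩ := hG q hq p' hp'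
    exact ⟨r, hr, hrq.trans hqp, Set.insert_subset (ThinCond.Extends.subset hrp' hx)
      (hSq.trans (ThinCond.Extends.subset hrq))⟩

lemma finite_labelLE_filter (hG : ∀ p ∈ G, ∀ q ∈ G, ∃ r ∈ G, r ≤ p ∧ r ≤ q)
    {p : ThinCond δ} (hp : p ∈ G) (j : ℕ) : (labelLE (⋃ p ∈ G, p.E) j).Finite := by
  by_contra hinf
  obtain ⟨S, hS, hfin, hcard⟩ := Set.Infinite.exists_subset_ncard_eq hinf (j + 2)
  obtain ⟨q, -, -, hSq⟩ := exists_mem_filter_subset hG hp hfin fun x hx => (hS hx).1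
  have := (Set.ncard_le_ncard (fun x hx => ⟨hSq hx, (hS hx).2⟩ : S ⊆ labelLE q.E j)
    (q.thin.finite j)).trans (q.count j)
  omega

lemma exists_mem_filter_ncard_le (hG : ∀ p ∈ G, ∀ q ∈ G, ∃ r ∈ G, r ≤ p ∧ r ≤ q)
    {p : ThinCond δ} (hp : p ∈ G) (j : ℕ) :
    ∃ q ∈ G, q ≤ p ∧ (labelLE (⋃ p ∈ G, p.E) j).ncard ≤ (labelLE q.E j).ncard := by
  obtain ⟨q, hq, hqp, hSq⟩ := exists_mem_filter_subset hG hp (finite_labelLE_filter hG hp j)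
    fun x hx => hx.1
  exact ⟨q, hq, hqp, Set.ncard_le_ncard (fun x hx => ⟨hSq hx, hx.2⟩) (q.thin.finite j)⟩

lemma thinLabels_filter (hG : ∀ p ∈ G, ∀ q ∈ G, ∃ r ∈ G, r ≤ p ∧ r ≤ q)
    (hk : ∀ m : ℕ, ∃ p ∈ G, m ≤ p.k) : ThinLabels (⋃ p ∈ G, p.E) where
  finite j := by
    obtain ⟨p, hp, -⟩ := hk 0
    exact finite_labelLE_filter hG hp j
  eventually_le m := by
    obtain ⟨p, hp, hm⟩ := hk m
    refine ⟨p.n, fun j hj => ?_⟩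
    obtain ⟨q, -, hqp, hle⟩ := exists_mem_filter_ncard_le hG hp j
    exact (Nat.mul_le_mul hm hle).trans (hqp.promise j hj)

end Generic

/-- Under Martin's axiom, `κ` many sets in `𝓜'` have a common thin coded cover. -/
lemma MartinsAxiom.exists_thin_cover {κ : Cardinal} (hMA : MartinsAxiom κ) {𝓕 : Set (Set ℝ)}
    (hcard : Cardinal.mk ↥𝓕 ≤ κ) (h𝓕 : ∀ M ∈ 𝓕, MPrime M) {δ : ℝ} (hδ : 0 < δ) :
    ∃ E, ShortCodes δ E ∧ ThinLabels E ∧ (∀ j, (labelLE E j).ncard ≤ j + 1) ∧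
      ⋃₀ 𝓕 ⊆ codedUnion E := by
  rcases lt_or_ge κ Cardinal.aleph0 with hκ | hκ
  · have hfin : 𝓕.Finite := Cardinal.lt_aleph0_iff_set_finite.1 (hcard.trans_lt hκ)
    obtain ⟨p, hp⟩ := ThinCond.exists_cover_of_finite hδ hfin h𝓕
    exact ⟨p.E, p.short, p.thin, p.count, hp⟩
  let 𝓚 : Set (Set (ThinCond δ)) := Set.range fun m : ℕ => {p | m ≤ p.k}
  let 𝓒 : Set (Set (ThinCond δ)) := (fun M => {p | M ⊆ codedUnion p.E}) '' 𝓕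
  have hsize : Cardinal.mk ↥(𝓚 ∪ 𝓒) ≤ κ := by
    refine (Cardinal.mk_union_le _ _).trans (Cardinal.add_le_of_le hκ ?_ ?_)
    · exact (Cardinal.mk_le_aleph0_iff.2 (Set.countable_range _).to_subtype).trans hκ
    · exact Cardinal.mk_image_le.trans hcard
  obtain ⟨G, -, hdir, hmeet⟩ := hMA (ThinCond δ) inferInstance ThinCond.countable_of_antichain
    (𝓚 ∪ 𝓒) hsize (by
      rintro _ (⟨m, rfl⟩ | ⟨M, hM, rfl⟩) p
      · obtain ⟨q, hq, hm⟩ := p.exists_le_k m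
        exact ⟨q, hm, hq⟩
      · obtain ⟨q, hq, hc⟩ := p.exists_le_cover hδ (h𝓕 M hM)
        exact ⟨q, hc, hq⟩)
  have hk : ∀ m : ℕ, ∃ p ∈ G, m ≤ p.k := fun m => hmeet _ (Or.inl ⟨m, rfl⟩)
  refine ⟨⋃ p ∈ G, p.E, fun x hx => ?_, thinLabels_filter hdir hk, fun j => ?_,
    Set.sUnion_subset fun M hM => ?_⟩
  · obtain ⟨p, -, hp⟩ := Set.mem_iUnion₂.1 hx
    exact p.short x hp
  · obtain ⟨p, hp, -⟩ := hk 0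
    obtain ⟨q, -, -, hle⟩ := exists_mem_filter_ncard_le hdir hp j
    exact hle.trans (q.count j)
  · obtain ⟨p, hp, hc⟩ := hmeet _ (Or.inr ⟨M, hM, rfl⟩)
    exact Set.Subset.trans hc (codedUnion_mono (Set.subset_biUnion_of_mem (u := ThinCond.E) hp))

theorem ma_union_mprime (κ : Cardinal) (hMA : MartinsAxiom κ) (𝓕 : Set (Set ℝ))
    (hcard : Cardinal.mk ↥𝓕 ≤ κ) (h𝓕 : ∀ M ∈ 𝓕, MPrime M) : MPrime (⋃₀ 𝓕) := by
  intro ε hε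
  have h0 : 0 < min ε 1 := lt_min hε one_pos
  obtain ⟨E, hshort, hthin, hcount, hcov⟩ :=
    hMA.exists_thin_cover hcard h𝓕 (pow_pos h0 2)
  obtain ⟨D, hD, J, hJ, hEJ, hvol⟩ :=
    exists_densityZero_cover h0 (min_le_right _ _) hshort hthin hcount
  exact ⟨D, hD, J, hJ, hcov.trans hEJ, fun d hd => (hvol d hd).trans
    (ENNReal.ofReal_le_ofReal (pow_le_pow_left₀ h0.le (min_le_left _ _) _))⟩
end
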